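/- arXiv:1112.0098 — 4 statements merged into one kernel-verified Lean document; each statement's English description precedes it below -/
import Mathlib

section
/- A function f : (0,∞) → (0,∞) is operator monotone if and only if it is operator concave. -/
open Matrix Set
open scoped ComplexOrder

noncomputable section

/-- `f` is `n`-matrix monotone on `I`. -/
def MatMonoOn (n : ℕ) (I : Set ℝ) (f : ℝ → ℝ) : Prop :=
  ∀ (A B : Matrix (Fin n) (Fin n) ℂ) (hA : A.IsHermitian) (hB : B.IsHermitian),
    (∀ i, hA.eigenvalues i ∈ I) → (∀ i, hB.eigenvalues i ∈ I) →
    (B - A).PosSemidef → (hB.cfc f - hA.cfc f).PosSemidef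

/-- `f` is `n`-matrix concave on `I`. -/
def MatConcaveOn (n : ℕ) (I : Set ℝ) (f : ℝ → ℝ) : Prop :=
  ∀ (A B : Matrix (Fin n) (Fin n) ℂ) (hA : A.IsHermitian) (hB : B.IsHermitian)
    (s : ℝ), s ∈ Icc (0:ℝ) 1 →
    (∀ i, hA.eigenvalues i ∈ I) → (∀ i, hB.eigenvalues i ∈ I) →
    ∀ (hC : ((s:ℂ) • A + ((1:ℂ) - (s:ℂ)) • B).IsHermitian),
      (hC.cfc f - ((s:ℂ) • hA.cfc f + ((1:ℂ) - (s:ℂ)) • hB.cfc f)).PosSemidef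

/-- `f` is `n`-matrix convex on `I`. -/
def MatConvexOn (n : ℕ) (I : Set ℝ) (f : ℝ → ℝ) : Prop :=
  ∀ (A B : Matrix (Fin n) (Fin n) ℂ) (hA : A.IsHermitian) (hB : B.IsHermitian)
    (s : ℝ), s ∈ Icc (0:ℝ) 1 →
    (∀ i, hA.eigenvalues i ∈ I) → (∀ i, hB.eigenvalues i ∈ I) →
    ∀ (hC : ((s:ℂ) • A + ((1:ℂ) - (s:ℂ)) • B).IsHermitian),
      (((s:ℂ) • hA.cfc f + ((1:ℂ) - (s:ℂ)) • hB.cfc f) - hC.cfc f).PosSemidef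

/-- First divided difference. -/
def dd (f : ℝ → ℝ) (t s : ℝ) : ℝ :=
  if t = s then deriv f t else (f t - f s) / (t - s)

/-- Second divided difference. -/
def dd2 (f : ℝ → ℝ) (t s r : ℝ) : ℝ :=
  if t = s then
    (if s = r then deriv (deriv f) t / 2 else (deriv f t - dd f t r) / (t - r))
  else if t = r then (deriv f t - dd f t s) / (t - s)
  else (dd f t s - dd f s r) / (t - r)

section FunctionalCalculus

variable {m k : Type*} [Fintype m] [DecidableEq m] [Fintype k] [DecidableEq k]

/-- Functional calculus of a Hermitian matrix agrees with evaluation of a polynomial agreeing with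
the function on the spectrum. -/
lemma cfc_eq_aeval_of_eqOn {A : Matrix m m ℂ} (hA : A.IsHermitian) {f : ℝ → ℝ}
    {p : Polynomial ℝ} (h : (spectrum ℝ A).EqOn f p.eval) :
    cfc f A = Polynomial.aeval A p := by
  rw [cfc_congr h]
  exact cfc_polynomial p A hA

lemma exists_polynomial_eqOn {S : Set ℝ} (hS : S.Finite) (f : ℝ → ℝ) :
    ∃ p : Polynomial ℝ, S.EqOn f p.eval :=
  ⟨Lagrange.interpolate hS.toFinset id f, fun _ hx =>
    (Lagrange.eval_interpolate_at_node (v := id) f (Set.injOn_id _)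
      (hS.mem_toFinset.mpr hx)).symm⟩

lemma finite_spectrum_real {A : Matrix m m ℂ} (hA : A.IsHermitian) : (spectrum ℝ A).Finite :=
  hA.spectrum_real_eq_range_eigenvalues ▸ Set.finite_range _

/-- The functional calculus of Hermitian matrices commutes with algebra homomorphisms. -/
lemma algHom_map_cfc (φ : Matrix m m ℂ →ₐ[ℝ] Matrix k k ℂ) {A : Matrix m m ℂ}
    (hA : A.IsHermitian) (hφ : (φ A).IsHermitian) (f : ℝ → ℝ) :
    cfc f (φ A) = φ (cfc f A) := by
  obtain ⟨p, hp⟩ := exists_polynomial_eqOn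
    ((finite_spectrum_real hA).union (finite_spectrum_real hφ)) f
  rw [cfc_eq_aeval_of_eqOn hA (hp.mono subset_union_left),
    cfc_eq_aeval_of_eqOn hφ (hp.mono subset_union_right), Polynomial.aeval_algHom_apply]

lemma aeval_fromBlocks_diagonal (A : Matrix m m ℂ) (B : Matrix k k ℂ) (p : Polynomial ℝ) :
    Polynomial.aeval (fromBlocks A 0 0 B) p =
      fromBlocks (Polynomial.aeval A p) 0 0 (Polynomial.aeval B p) := by
  induction p using Polynomial.induction_on' with
  | add p q hp hq => simp [hp, hq, fromBlocks_add]
  | monomial n a =>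
    simp only [Polynomial.aeval_monomial, ← Algebra.smul_def, fromBlocks_diagonal_pow,
      fromBlocks_smul, smul_zero]

lemma cfc_fromBlocks_diagonal {A : Matrix m m ℂ} {B : Matrix k k ℂ} (hA : A.IsHermitian)
    (hB : B.IsHermitian) (f : ℝ → ℝ) :
    cfc f (fromBlocks A 0 0 B) = fromBlocks (cfc f A) 0 0 (cfc f B) := by
  have hAB : (fromBlocks A 0 0 B).IsHermitian := hA.fromBlocks (by simp) hB
  obtain ⟨p, hp⟩ := exists_polynomial_eqOn (((finite_spectrum_real hA).union
    (finite_spectrum_real hB)).union (finite_spectrum_real hAB)) f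
  rw [cfc_eq_aeval_of_eqOn hA (hp.mono fun _ hx => .inl (.inl hx)),
    cfc_eq_aeval_of_eqOn hB (hp.mono fun _ hx => .inl (.inr hx)),
    cfc_eq_aeval_of_eqOn hAB (hp.mono fun _ hx => .inr hx), aeval_fromBlocks_diagonal]

lemma cfc_posSemidef {f : ℝ → ℝ} (hpos : ∀ t ∈ Ioi (0:ℝ), 0 < f t) {A : Matrix m m ℂ}
    (hA : A.PosDef) : (cfc f A).PosSemidef := by
  rw [hA.isHermitian.cfc_eq, IsHermitian.cfc, Unitary.conjStarAlgAut_apply]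
  refine PosSemidef.mul_mul_conjTranspose_same (PosSemidef.diagonal fun i => ?_) _
  simpa using (hpos _ (hA.eigenvalues_pos i)).le

end FunctionalCalculus

section Order

variable {m : Type*}

lemma posDef_ofReal_smul {A : Matrix m m ℂ} (hA : A.PosDef) {t : ℝ} (ht : 0 < t) :
    ((t:ℂ) • A).PosDef :=
  hA.smul (by exact_mod_cast ht)

lemma posSemidef_ofReal_smul {A : Matrix m m ℂ} (hA : A.PosSemidef) {t : ℝ} (ht : 0 ≤ t) :
    ((t:ℂ) • A).PosSemidef :=
  hA.smul (by exact_mod_cast ht)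

/-- A convex combination of positive definite matrices is positive definite. -/
lemma posDef_convex_combination {A B : Matrix m m ℂ} (hA : A.PosDef) (hB : B.PosDef) {s : ℝ}
    (hs : s ∈ Icc (0:ℝ) 1) : ((s:ℂ) • A + ((1:ℂ) - (s:ℂ)) • B).PosDef := by
  rcases hs.1.eq_or_lt with rfl | h0
  · simpa using hB
  · have := posSemidef_ofReal_smul hB.posSemidef (sub_nonneg.mpr hs.2)
    push_cast at this
    exact (posDef_ofReal_smul hA h0).add_posSemidef this

lemma posDef_fromBlocks_diagonal [Fintype m] [DecidableEq m] {A B : Matrix m m ℂ}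
    (hA : A.PosDef) (hB : B.PosDef) : (fromBlocks A 0 0 B).PosDef := by
  have : Invertible A := hA.isUnit.invertible
  have h : (fromBlocks A 0 0 B).PosSemidef := by
    simpa using (PosDef.fromBlocks₁₁ 0 B hA).mpr (by simpa using hB.posSemidef)
  rw [h.posDef_iff_isUnit, isUnit_iff_isUnit_det, det_fromBlocks_zero₂₁]
  exact ((isUnit_iff_isUnit_det A).mp hA.isUnit).mul ((isUnit_iff_isUnit_det B).mp hB.isUnit)

/-- The Loewner order is closed under letting a scalar factor tend to one from below. -/
lemma posSemidef_sub_of_forall_smul [Fintype m] {F G : Matrix m m ℂ}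
    (h : ∀ t : ℝ, 0 < t → t < 1 → (F - (t:ℂ) • G).PosSemidef) (hG : G.IsHermitian) :
    (F - G).PosSemidef := by
  have hF : F.IsHermitian := by
    have := (h (1/2) (by norm_num) (by norm_num)).1.add
      (hG.smul (k := (((1/2 : ℝ)) : ℂ)) (Complex.conj_ofReal _))
    simpa using this
  refine .of_dotProduct_mulVec_nonneg (hF.sub hG) fun x => ?_
  have hlim : Filter.Tendsto (fun t : ℝ => star x ⬝ᵥ ((F - (t:ℂ) • G) *ᵥ x))
      (nhdsWithin 1 (Ioo 0 1)) (nhds (star x ⬝ᵥ ((F - G) *ᵥ x))) := by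
    have hc : Continuous (fun t : ℝ => star x ⬝ᵥ ((F - (t:ℂ) • G) *ᵥ x)) := by fun_prop
    simpa using (hc.tendsto 1).mono_left nhdsWithin_le_nhds
  have : (nhdsWithin (1:ℝ) (Ioo 0 1)).NeBot := by
    rw [← mem_closure_iff_nhdsWithin_neBot, closure_Ioo zero_ne_one]
    simp
  refine ge_of_tendsto hlim ?_
  filter_upwards [self_mem_nhdsWithin] with t ht
  exact (h t ht.1 ht.2).dotProduct_mulVec_nonneg x

end Order

/-- Matrix monotonicity, for matrices over an arbitrary finite index type. -/
lemma posSemidef_cfc_sub_of_matMonoOn {m : Type*} [Fintype m] [DecidableEq m] {f : ℝ → ℝ}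
    (hf : ∀ n, MatMonoOn n (Ioi 0) f) {A B : Matrix m m ℂ} (hA : A.PosDef) (hB : B.PosDef)
    (hAB : (B - A).PosSemidef) : (cfc f B - cfc f A).PosSemidef := by
  let e := Fintype.equivFin m
  let φ : Matrix m m ℂ →ₐ[ℝ] Matrix (Fin (Fintype.card m)) (Fin (Fintype.card m)) ℂ :=
    (reindexAlgEquiv ℝ ℂ e).toAlgHom
  have hφ : ∀ M, φ M = M.submatrix e.symm e.symm := fun M => rfl
  have hA' : (φ A).PosDef := hφ A ▸ hA.submatrix e.symm.injective
  have hB' : (φ B).PosDef := hφ B ▸ hB.submatrix e.symm.injective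
  have h := hf _ _ _ hA'.isHermitian hB'.isHermitian hA'.eigenvalues_pos hB'.eigenvalues_pos
    (by rw [← map_sub, hφ]; exact hAB.submatrix _)
  rw [← IsHermitian.cfc_eq, ← IsHermitian.cfc_eq,
    algHom_map_cfc φ hA.isHermitian hA'.isHermitian,
    algHom_map_cfc φ hB.isHermitian hB'.isHermitian, ← map_sub, hφ] at h
  exact (posSemidef_submatrix_equiv e.symm).mp h

section Monotone

variable {m : Type*} [Fintype m] [DecidableEq m]

/-- The rotation by an angle with cosine `c` and sine `d`, as a block matrix. -/
def blockRotation (m : Type*) [DecidableEq m] (c d : ℝ) : Matrix (m ⊕ m) (m ⊕ m) ℂ :=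
  fromBlocks ((c:ℂ) • 1) ((-d:ℂ) • 1) ((d:ℂ) • 1) ((c:ℂ) • 1)

lemma blockRotation_mem_unitary {c d : ℝ} (h : c ^ 2 + d ^ 2 = 1) :
    blockRotation m c d ∈ unitary (Matrix (m ⊕ m) (m ⊕ m) ℂ) := by
  have h' : c * c + d * d = 1 := by rw [← sq, ← sq, h]
  have h'' : d * d + c * c = 1 := by rw [add_comm, h']
  rw [Unitary.mem_iff, star_eq_conjTranspose, blockRotation, fromBlocks_conjTranspose,
    fromBlocks_multiply, fromBlocks_multiply]
  simp [smul_smul, ← add_smul, h', h'', mul_comm c d, fromBlocks_one]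

lemma blockRotation_conj (c d : ℝ) (A B : Matrix m m ℂ) :
    star (blockRotation m c d) * fromBlocks A 0 0 B * blockRotation m c d =
      fromBlocks (((c ^ 2 : ℝ):ℂ) • A + ((d ^ 2 : ℝ):ℂ) • B) (((c * d : ℝ):ℂ) • (B - A))
        (((c * d : ℝ):ℂ) • (B - A)) (((d ^ 2 : ℝ):ℂ) • A + ((c ^ 2 : ℝ):ℂ) • B) := by
  rw [star_eq_conjTranspose, blockRotation, fromBlocks_conjTranspose,
    fromBlocks_multiply, fromBlocks_multiply]
  simp only [fromBlocks_inj]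
  refine ⟨?_, ?_, ?_, ?_⟩ <;> ext i j <;> simp <;> ring

/-- A monotone function satisfies a concavity inequality with a strictly larger matrix in place
of the convex combination. -/
lemma posSemidef_cfc_sub_convex_combination {f : ℝ → ℝ} (hf : ∀ n, MatMonoOn n (Ioi 0) f)
    {A B D : Matrix m m ℂ} (hA : A.PosDef) (hB : B.PosDef) {s : ℝ} (hs : s ∈ Icc (0:ℝ) 1)
    (hD : (D - ((s:ℂ) • A + ((1:ℂ) - (s:ℂ)) • B)).PosDef) :
    (cfc f D - ((s:ℂ) • cfc f A + ((1:ℂ) - (s:ℂ)) • cfc f B)).PosSemidef := by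
  set C := (s:ℂ) • A + ((1:ℂ) - (s:ℂ)) • B with hC
  have hCpos : C.PosDef := posDef_convex_combination hA hB hs
  set c := √s
  set d := √(1 - s)
  have hc : c ^ 2 = s := Real.sq_sqrt hs.1
  have hd : d ^ 2 = 1 - s := Real.sq_sqrt (sub_nonneg.mpr hs.2)
  let U : unitary (Matrix (m ⊕ m) (m ⊕ m) ℂ) :=
    ⟨blockRotation m c d, blockRotation_mem_unitary (by rw [hc, hd]; ring)⟩
  let φ : Matrix (m ⊕ m) (m ⊕ m) ℂ →ₐ[ℝ] Matrix (m ⊕ m) (m ⊕ m) ℂ :=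
    (Unitary.conjStarAlgAut ℝ _ (star U)).toAlgEquiv.toAlgHom
  have hφ : ∀ M, φ M = star (blockRotation m c d) * M * blockRotation m c d := fun M => by
    simp [φ, U, Unitary.conjStarAlgAut_apply]
  set X : Matrix m m ℂ := ((c * d : ℝ):ℂ) • (B - A) with hX
  have hXh : Xᴴ = X := by
    simp [hX, conjTranspose_smul, hA.isHermitian.eq, hB.isHermitian.eq]
  set E : Matrix m m ℂ := ((d ^ 2 : ℝ):ℂ) • A + ((c ^ 2 : ℝ):ℂ) • B with hE
  have hEpos : E.PosDef := by
    have := posDef_convex_combination hB hA hs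
    rw [hE, hc, hd, add_comm]
    push_cast
    exact this
  have hT := posDef_fromBlocks_diagonal hA hB
  have hφT : φ (fromBlocks A 0 0 B) = fromBlocks C X X E := by
    rw [hφ, blockRotation_conj, hC, hc, hd]
    simp [hX, hE, hc, hd]
  have hφpos : (φ (fromBlocks A 0 0 B)).PosDef := by
    rw [hφ]
    exact (Unitary.isUnit_coe (U := U)).posDef_star_left_conjugate_iff.mpr hT
  set L : Matrix m m ℂ := E + Xᴴ * (D - C)⁻¹ * X with hL
  have hLpos : L.PosDef :=
    hEpos.add_posSemidef (hD.inv.posSemidef.conjTranspose_mul_mul_same X)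
  have hDpos : D.PosDef := by simpa using hD.add hCpos
  have hDL := posDef_fromBlocks_diagonal hDpos hLpos
  have hle : (fromBlocks D 0 0 L - φ (fromBlocks A 0 0 B)).PosSemidef := by
    have : Invertible (D - C) := hD.isUnit.invertible
    have h := (PosDef.fromBlocks₁₁ (-X) (L - E) hD).mpr (by simp [hL, PosSemidef.zero])
    rw [hφT, sub_eq_add_neg, fromBlocks_neg, fromBlocks_add]
    simpa [sub_eq_add_neg, hXh] using h
  have h := posSemidef_cfc_sub_of_matMonoOn hf hφpos hDL hle
  rw [algHom_map_cfc φ hT.isHermitian hφpos.isHermitian,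
    cfc_fromBlocks_diagonal hA.isHermitian hB.isHermitian,
    cfc_fromBlocks_diagonal hDpos.isHermitian hLpos.isHermitian, hφ, blockRotation_conj,
    sub_eq_add_neg, fromBlocks_neg, fromBlocks_add, hc, hd] at h
  have := h.submatrix Sum.inl
  push_cast at this
  rwa [sub_eq_add_neg]

/-- A positive monotone function satisfies `u f(A) ≤ f(tA)` for `0 < u < t`. -/
lemma posSemidef_cfc_smul_sub_smul_cfc {f : ℝ → ℝ} (hpos : ∀ t ∈ Ioi (0:ℝ), 0 < f t)
    (hf : ∀ n, MatMonoOn n (Ioi 0) f) {A : Matrix m m ℂ} (hA : A.PosDef) {u t : ℝ}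
    (hu : u ∈ Icc (0:ℝ) 1) (hut : u < t) :
    (cfc f ((t:ℂ) • A) - (u:ℂ) • cfc f A).PosSemidef := by
  have hr : 0 < (t - u) / 2 := by linarith
  have hB := posDef_ofReal_smul hA hr
  have h := posSemidef_cfc_sub_convex_combination (D := (t:ℂ) • A) hf hA hB hu (by
    have : 0 < t - (u + (1 - u) * ((t - u) / 2)) := by
      nlinarith [mul_nonneg hu.1 (sub_nonneg.mpr hut.le)]
    convert posDef_ofReal_smul hA this using 1
    push_cast
    module)
  have h' := posSemidef_ofReal_smul (cfc_posSemidef hpos hB) (sub_nonneg.mpr hu.2)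
  convert h.add h' using 1
  push_cast
  module

end Monotone

lemma matConcaveOn_of_matMonoOn {f : ℝ → ℝ} (hpos : ∀ t ∈ Ioi (0:ℝ), 0 < f t)
    (hf : ∀ n, MatMonoOn n (Ioi 0) f) (n : ℕ) : MatConcaveOn n (Ioi 0) f := by
  intro A B hA hB s hs hAe hBe hC
  have hAp : A.PosDef := hA.posDef_iff_eigenvalues_pos.mpr hAe
  have hBp : B.PosDef := hB.posDef_iff_eigenvalues_pos.mpr hBe
  simp only [← IsHermitian.cfc_eq]
  have hs' : (0:ℝ) ≤ 1 - s := sub_nonneg.mpr hs.2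
  have hG := (posSemidef_ofReal_smul (cfc_posSemidef hpos hAp) hs.1).add
    (posSemidef_ofReal_smul (cfc_posSemidef hpos hBp) hs')
  push_cast at hG
  refine posSemidef_sub_of_forall_smul (fun u hu hu1 => ?_) hG.isHermitian
  set t := (u + 1) / 2
  have hut : u < t := by simp only [t]; linarith
  have ht1 : 0 < 1 - t := by simp only [t]; linarith
  have ht : 0 < t := hu.trans hut
  have h := posSemidef_cfc_sub_convex_combination
    (D := (s:ℂ) • A + ((1:ℂ) - (s:ℂ)) • B) hf
    (posDef_ofReal_smul hAp ht) (posDef_ofReal_smul hBp ht) hs (by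
      convert posDef_ofReal_smul (posDef_convex_combination hAp hBp hs) ht1 using 1
      push_cast
      module)
  have h1 := posSemidef_ofReal_smul
    (posSemidef_cfc_smul_sub_smul_cfc hpos hf hAp ⟨hu.le, hu1.le⟩ hut) hs.1
  have h2 := posSemidef_ofReal_smul
    (posSemidef_cfc_smul_sub_smul_cfc hpos hf hBp ⟨hu.le, hu1.le⟩ hut) hs'
  convert (h.add h1).add h2 using 1
  push_cast
  module

lemma matMonoOn_of_matConcaveOn {f : ℝ → ℝ} (hpos : ∀ t ∈ Ioi (0:ℝ), 0 < f t) {n : ℕ}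
    (hf : MatConcaveOn n (Ioi 0) f) : MatMonoOn n (Ioi 0) f := by
  intro A B hA hB hAe hBe hAB
  have hAp : A.PosDef := hA.posDef_iff_eigenvalues_pos.mpr hAe
  have hBp : B.PosDef := hB.posDef_iff_eigenvalues_pos.mpr hBe
  simp only [← IsHermitian.cfc_eq]
  refine posSemidef_sub_of_forall_smul (fun s hs hs1 => ?_) (cfc_posSemidef hpos hAp).isHermitian
  have hs' : 0 < 1 - s := by linarith
  have hne : (1:ℂ) - s ≠ 0 := by exact_mod_cast hs'.ne'
  have hD : (((s:ℂ) • (B - A)) + ((1 - s : ℝ):ℂ) • B).PosDef :=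
    (posDef_ofReal_smul hBp hs').posSemidef_add (posSemidef_ofReal_smul hAB hs.le)
  have hE := posDef_ofReal_smul hD (inv_pos.mpr hs')
  set E := (((1 - s)⁻¹ : ℝ):ℂ) • (((s:ℂ) • (B - A)) + ((1 - s : ℝ):ℂ) • B) with hEdef
  have hB' : (s:ℂ) • A + ((1:ℂ) - (s:ℂ)) • E = B := by
    rw [hEdef, smul_smul]
    push_cast
    rw [mul_inv_cancel₀ hne]
    module
  have h := hf A E hA hE.isHermitian s ⟨hs.le, hs1.le⟩ hAe hE.eigenvalues_pos (hB' ▸ hB)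
  simp only [← IsHermitian.cfc_eq, hB'] at h
  have h' := posSemidef_ofReal_smul (cfc_posSemidef hpos hE) hs'.le
  convert h.add h' using 1
  push_cast
  module

theorem stmt2 (f : ℝ → ℝ) (hpos : ∀ t ∈ Ioi (0:ℝ), 0 < f t) :
    (∀ n, MatMonoOn n (Ioi 0) f) ↔ (∀ n, MatConcaveOn n (Ioi 0) f) :=
  ⟨matConcaveOn_of_matMonoOn hpos, fun h n => matMonoOn_of_matConcaveOn hpos (h n)⟩

end
end

section
/- Let f ∈ C¹(I) on an open interval I and n ≥ 1. Then f is n-matrix monotone if and only if for all λ₁,…,λₙ ∈ I the Löwner matrix L(λ₁,…,λₙ) = ([λᵢ,λⱼ]_f)ᵢⱼ is positive semidefinite. -/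
open Matrix Set
open scoped ComplexOrder

noncomputable section

open Filter Topology

/-- The Hermitian matrix with eigenvalues `a` and eigenvectors the columns of `U`. -/
def unitaryConj {n : ℕ} (U : Matrix (Fin n) (Fin n) ℂ) (a : Fin n → ℝ) :
    Matrix (Fin n) (Fin n) ℂ :=
  U * diagonal (fun i => (a i : ℂ)) * Uᴴ

/-- The complex matrix of divided differences of `f` between two families of nodes. -/
def ddMatrix {n : ℕ} (f : ℝ → ℝ) (a b : Fin n → ℝ) : Matrix (Fin n) (Fin n) ℂ :=
  Matrix.of fun i j => ((dd f (a i) (b j) : ℝ) : ℂ)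

/-- The derivative of the functional calculus of `f` at `unitaryConj U a` in the direction `H`. -/
def cfcDeriv {n : ℕ} (f : ℝ → ℝ) (U : Matrix (Fin n) (Fin n) ℂ) (a : Fin n → ℝ)
    (H : Matrix (Fin n) (Fin n) ℂ) : Matrix (Fin n) (Fin n) ℂ :=
  U * (ddMatrix f a a ⊙ (Uᴴ * H * U)) * Uᴴ

section

variable {n : ℕ} {U V A H : Matrix (Fin n) (Fin n) ℂ} {a b : Fin n → ℝ} {f : ℝ → ℝ} {I : Set ℝ}

lemma conjTranspose_mul_self_of_mem_unitaryGroup (hU : U ∈ unitaryGroup (Fin n) ℂ) :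
    Uᴴ * U = 1 := by
  simpa [star_eq_conjTranspose] using mem_unitaryGroup_iff'.1 hU

lemma mul_conjTranspose_self_of_mem_unitaryGroup (hU : U ∈ unitaryGroup (Fin n) ℂ) :
    U * Uᴴ = 1 := by
  simpa [star_eq_conjTranspose] using mem_unitaryGroup_iff.1 hU

lemma Matrix.IsHermitian.eq_unitaryConj (hA : A.IsHermitian) :
    A = unitaryConj (hA.eigenvectorUnitary : Matrix (Fin n) (Fin n) ℂ) hA.eigenvalues := by
  conv_lhs => rw [hA.spectral_theorem]
  rfl

lemma isHermitian_unitaryConj (U : Matrix (Fin n) (Fin n) ℂ) (a : Fin n → ℝ) :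
    (unitaryConj U a).IsHermitian := by
  refine isHermitian_mul_mul_conjTranspose U (isHermitian_diagonal_of_self_adjoint _ ?_)
  ext i
  simp

lemma conjTranspose_mul_unitaryConj_mul (hU : U ∈ unitaryGroup (Fin n) ℂ) (a : Fin n → ℝ)
    (V : Matrix (Fin n) (Fin n) ℂ) :
    Uᴴ * unitaryConj U a * V = diagonal (fun i => (a i : ℂ)) * (Uᴴ * V) := by
  simp only [unitaryConj, ← Matrix.mul_assoc, conjTranspose_mul_self_of_mem_unitaryGroup hU,
    Matrix.one_mul]

lemma mul_unitaryConj_mul_self (hV : V ∈ unitaryGroup (Fin n) ℂ) (b : Fin n → ℝ)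
    (U : Matrix (Fin n) (Fin n) ℂ) :
    Uᴴ * unitaryConj V b * V = (Uᴴ * V) * diagonal (fun i => (b i : ℂ)) := by
  simp only [unitaryConj, Matrix.mul_assoc, conjTranspose_mul_self_of_mem_unitaryGroup hV,
    Matrix.mul_one]

lemma dd_mul_sub (f : ℝ → ℝ) (t s : ℝ) : dd f t s * (s - t) = f s - f t := by
  unfold dd
  split_ifs with h
  · simp [h]
  · have : t - s ≠ 0 := sub_ne_zero.2 h
    field_simp
    ring

/-- The difference of two values of the functional calculus in terms of divided differences. -/
lemma unitaryConj_comp_sub (hU : U ∈ unitaryGroup (Fin n) ℂ) (hV : V ∈ unitaryGroup (Fin n) ℂ)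
    (f : ℝ → ℝ) (a b : Fin n → ℝ) :
    unitaryConj V (f ∘ b) - unitaryConj U (f ∘ a) =
      U * (ddMatrix f a b ⊙ (Uᴴ * (unitaryConj V b - unitaryConj U a) * V)) * Vᴴ := by
  have key : ddMatrix f a b ⊙ (Uᴴ * (unitaryConj V b - unitaryConj U a) * V) =
      Uᴴ * (unitaryConj V (f ∘ b) - unitaryConj U (f ∘ a)) * V := by
    rw [Matrix.mul_sub, Matrix.sub_mul, Matrix.mul_sub, Matrix.sub_mul,
      conjTranspose_mul_unitaryConj_mul hU, mul_unitaryConj_mul_self hV,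
      conjTranspose_mul_unitaryConj_mul hU, mul_unitaryConj_mul_self hV]
    ext i j
    have h : (dd f (a i) (b j) : ℂ) * (b j - a i) = f (b j) - f (a i) := by
      exact_mod_cast dd_mul_sub f (a i) (b j)
    simp only [hadamard_apply, ddMatrix, of_apply, Matrix.sub_apply, mul_diagonal, diagonal_mul,
      Function.comp_apply]
    linear_combination (Uᴴ * V) i j * h
  rw [key, ← Matrix.mul_assoc, ← Matrix.mul_assoc, Matrix.mul_assoc,
    mul_conjTranspose_self_of_mem_unitaryGroup hU, mul_conjTranspose_self_of_mem_unitaryGroup hV,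
    Matrix.one_mul, Matrix.mul_one]

/-- The functional calculus does not depend on the choice of spectral decomposition. -/
lemma unitaryConj_comp_eq (hU : U ∈ unitaryGroup (Fin n) ℂ) (hV : V ∈ unitaryGroup (Fin n) ℂ)
    (h : unitaryConj U a = unitaryConj V b) (f : ℝ → ℝ) :
    unitaryConj U (f ∘ a) = unitaryConj V (f ∘ b) := by
  have key := unitaryConj_comp_sub hU hV f a b
  rw [← h, sub_self, Matrix.mul_zero, Matrix.zero_mul, hadamard_zero, Matrix.mul_zero,
    Matrix.zero_mul] at key
  exact (sub_eq_zero.1 key).symm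

lemma eq_or_overlap_eq_zero (hU : U ∈ unitaryGroup (Fin n) ℂ) (hV : V ∈ unitaryGroup (Fin n) ℂ)
    (h : unitaryConj U a = unitaryConj V b) (i j : Fin n) :
    a i = b j ∨ (Uᴴ * V) i j = 0 := by
  have h1 := conjTranspose_mul_unitaryConj_mul hU a V
  rw [h, mul_unitaryConj_mul_self hV] at h1
  have h2 := congrFun (congrFun h1 i) j
  rw [mul_diagonal, diagonal_mul] at h2
  have h3 : ((a i : ℂ) - b j) * (Uᴴ * V) i j = 0 := by linear_combination -h2
  rcases mul_eq_zero.1 h3 with h4 | h4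
  · left
    exact_mod_cast sub_eq_zero.1 h4
  · exact Or.inr h4

lemma exists_eq_of_unitaryConj_eq (hU : U ∈ unitaryGroup (Fin n) ℂ)
    (hV : V ∈ unitaryGroup (Fin n) ℂ) (h : unitaryConj U a = unitaryConj V b) (j : Fin n) :
    ∃ i, a i = b j := by
  by_contra! hne
  have h0 : ∀ i, (Uᴴ * V) i j = 0 := fun i =>
    (eq_or_overlap_eq_zero hU hV h i j).resolve_left (hne i)
  have h1 : ∀ i, V i j = 0 := fun i => by
    have hUV : V = U * (Uᴴ * V) := by
      rw [← Matrix.mul_assoc, mul_conjTranspose_self_of_mem_unitaryGroup hU, Matrix.one_mul]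
    rw [hUV, mul_apply]
    simp [h0]
  have h2 := congrFun (congrFun (conjTranspose_mul_self_of_mem_unitaryGroup hV) j) j
  rw [mul_apply] at h2
  simp [h1] at h2

lemma ddMatrix_conj_eq_cfcDeriv (hU : U ∈ unitaryGroup (Fin n) ℂ)
    (hV : V ∈ unitaryGroup (Fin n) ℂ) (h : unitaryConj U a = unitaryConj V b)
    (f : ℝ → ℝ) (H : Matrix (Fin n) (Fin n) ℂ) :
    U * (ddMatrix f a b ⊙ (Uᴴ * H * V)) * Vᴴ = cfcDeriv f U a H := by
  have key : ddMatrix f a b ⊙ (Uᴴ * H * V) = (ddMatrix f a a ⊙ (Uᴴ * H * U)) * (Uᴴ * V) := by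
    have hK : Uᴴ * H * V = (Uᴴ * H * U) * (Uᴴ * V) := by
      rw [← Matrix.mul_assoc, Matrix.mul_assoc (Uᴴ * H) U,
        mul_conjTranspose_self_of_mem_unitaryGroup hU, Matrix.mul_one]
    rw [hK]
    ext i j
    rw [hadamard_apply, mul_apply, mul_apply, Finset.mul_sum]
    refine Finset.sum_congr rfl fun k _ => ?_
    rcases eq_or_overlap_eq_zero hU hV h k j with e | e
    · simp only [ddMatrix, hadamard_apply, of_apply, e]
      ring
    · simp [e]
  rw [key, cfcDeriv, Matrix.mul_assoc U, Matrix.mul_assoc _ (Uᴴ * V), Matrix.mul_assoc Uᴴ V,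
    mul_conjTranspose_self_of_mem_unitaryGroup hV, Matrix.mul_one, Matrix.mul_assoc U]

lemma isCompact_unitaryGroup :
    IsCompact (unitaryGroup (Fin n) ℂ : Set (Matrix (Fin n) (Fin n) ℂ)) := by
  have hK : IsCompact (Set.pi univ fun _ : Fin n => Set.pi univ fun _ : Fin n =>
      Metric.closedBall (0 : ℂ) 1) :=
    isCompact_univ_pi fun _ => isCompact_univ_pi fun _ => isCompact_closedBall 0 1
  refine IsCompact.of_isClosed_subset hK ?_ fun U hU i _ j _ => ?_
  · have : (unitaryGroup (Fin n) ℂ : Set (Matrix (Fin n) (Fin n) ℂ)) = {U | U * star U = 1} := by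
      ext U
      exact mem_unitaryGroup_iff
    rw [this]
    exact isClosed_eq (by fun_prop) continuous_const
  · simpa using entry_norm_bound_of_unitary hU i j

/-- Spectral decompositions of a convergent sequence of matrices subconverge. -/
lemma exists_subseq_unitaryConj {V : ℕ → Matrix (Fin n) (Fin n) ℂ} {b : ℕ → Fin n → ℝ}
    (hV : ∀ k, V k ∈ unitaryGroup (Fin n) ℂ)
    (hlim : Tendsto (fun k => unitaryConj (V k) (b k)) atTop (𝓝 A)) :
    ∃ φ : ℕ → ℕ, ∃ W ∈ unitaryGroup (Fin n) ℂ, ∃ c : Fin n → ℝ, StrictMono φ ∧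
      Tendsto (V ∘ φ) atTop (𝓝 W) ∧ Tendsto (b ∘ φ) atTop (𝓝 c) ∧ unitaryConj W c = A := by
  have : FirstCountableTopology (Matrix (Fin n) (Fin n) ℂ) :=
    inferInstanceAs (FirstCountableTopology (Fin n → Fin n → ℂ))
  obtain ⟨W, hW, φ, hφ, hφlim⟩ := isCompact_unitaryGroup.tendsto_subseq hV
  have hb : ∀ k i, b k i = (((V k)ᴴ * unitaryConj (V k) (b k) * V k) i i).re := fun k i => by
    rw [mul_unitaryConj_mul_self (hV k), conjTranspose_mul_self_of_mem_unitaryGroup (hV k)]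
    simp
  have hA := hlim.comp hφ.tendsto_atTop
  have hc : Tendsto (b ∘ φ) atTop (𝓝 fun i => ((Wᴴ * A * W) i i).re) := by
    rw [tendsto_pi_nhds]
    intro i
    have hcont : Continuous fun p : Matrix (Fin n) (Fin n) ℂ × Matrix (Fin n) (Fin n) ℂ =>
        ((p.1ᴴ * p.2 * p.1) i i).re :=
      Complex.continuous_re.comp (Continuous.matrix_elem (by fun_prop) i i)
    refine (hcont.tendsto (W, A) |>.comp (hφlim.prodMk_nhds hA)).congr fun k => ?_
    exact (hb (φ k) i).symm
  refine ⟨φ, W, hW, _, hφ, hφlim, hc, ?_⟩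
  have hcont : Continuous fun p : Matrix (Fin n) (Fin n) ℂ × (Fin n → ℝ) =>
      unitaryConj p.1 p.2 := by
    unfold unitaryConj
    refine Continuous.matrix_mul (Continuous.matrix_mul (by fun_prop)
      (Continuous.matrix_diagonal ?_)) (by fun_prop)
    fun_prop
  exact tendsto_nhds_unique ((hcont.tendsto (W, _)).comp (hφlim.prodMk_nhds hc)) hA

lemma continuousAt_dd (hI : IsOpen I) (hf : ContDiffOn ℝ 1 f I) {t s : ℝ} (ht : t ∈ I)
    (hs : s ∈ I) : ContinuousAt (fun p : ℝ × ℝ => dd f p.1 p.2) (t, s) := by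
  have hft : ContDiffAt ℝ 1 f t := hf.contDiffAt (hI.mem_nhds ht)
  have hfs : ContDiffAt ℝ 1 f s := hf.contDiffAt (hI.mem_nhds hs)
  by_cases h : t = s
  · subst h
    have hstrict : HasStrictDerivAt f (deriv f t) t := hft.hasStrictDerivAt one_ne_zero
    have hder : ContinuousAt (deriv f) t :=
      ((hf.continuousOn_deriv_of_isOpen hI le_rfl).continuousAt (hI.mem_nhds ht))
    rw [Metric.continuousAt_iff']
    intro ε hε
    have h1 := hstrict.isLittleO.def (half_pos hε)
    have h2 : ∀ᶠ p : ℝ × ℝ in 𝓝 (t, t), dist (deriv f p.1) (deriv f t) < ε :=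
      (continuous_fst.tendsto (t, t)).eventually (Metric.continuousAt_iff'.1 hder ε hε)
    filter_upwards [h1, h2] with p hp1 hp2
    by_cases hp : p.1 = p.2
    · simpa [dd, hp] using hp2
    · have hne : p.1 - p.2 ≠ 0 := sub_ne_zero.2 hp
      have hpos : 0 < |p.1 - p.2| := abs_pos.2 hne
      have hval : dd f p.1 p.2 - dd f t t =
          (f p.1 - f p.2 - (p.1 - p.2) * deriv f t) / (p.1 - p.2) := by
        simp only [dd, hp, if_true, if_false]
        field_simp
      rw [Real.dist_eq, hval, abs_div, div_lt_iff₀ hpos]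
      simp only [ContinuousLinearMap.toSpanSingleton_apply, smul_eq_mul, Real.norm_eq_abs] at hp1
      nlinarith
  · have hev : (fun p : ℝ × ℝ => (f p.1 - f p.2) / (p.1 - p.2)) =ᶠ[𝓝 (t, s)]
        fun p => dd f p.1 p.2 := by
      have : ∀ᶠ p : ℝ × ℝ in 𝓝 (t, s), p.1 ≠ p.2 :=
        (isOpen_ne_fun continuous_fst continuous_snd).mem_nhds h
      filter_upwards [this] with p hp
      simp [dd, hp]
    refine ContinuousAt.congr ?_ hev
    have c1 : ContinuousAt (fun p : ℝ × ℝ => f p.1) (t, s) :=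
      ContinuousAt.comp (f := Prod.fst) (x := (t, s)) hft.continuousAt continuousAt_fst
    have c2 : ContinuousAt (fun p : ℝ × ℝ => f p.2) (t, s) :=
      ContinuousAt.comp (f := Prod.snd) (x := (t, s)) hfs.continuousAt continuousAt_snd
    exact (c1.sub c2).div (by fun_prop) (sub_ne_zero.2 h)

lemma tendsto_unitaryConj_add_smul {V : ℝ → Matrix (Fin n) (Fin n) ℂ} {b : ℝ → Fin n → ℝ}
    (hdec : ∀ h, unitaryConj (V h) (b h) = A + (h : ℂ) • H) :
    Tendsto (fun h => unitaryConj (V h) (b h)) (𝓝 0) (𝓝 A) := by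
  simp only [hdec]
  have : Continuous fun h : ℝ => A + (h : ℂ) • H := by fun_prop
  simpa using this.tendsto 0

/-- The eigenvalues of a perturbation stay in an open set containing those of the matrix. -/
lemma eventually_eigenvalues_mem (hI : IsOpen I) (hU : U ∈ unitaryGroup (Fin n) ℂ)
    (ha : ∀ i, a i ∈ I) {V : ℝ → Matrix (Fin n) (Fin n) ℂ} {b : ℝ → Fin n → ℝ}
    (hV : ∀ h, V h ∈ unitaryGroup (Fin n) ℂ)
    (hdec : ∀ h : ℝ, unitaryConj (V h) (b h) = unitaryConj U a + (h : ℂ) • H) :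
    ∀ᶠ h in 𝓝 0, ∀ i, b h i ∈ I := by
  have : Tendsto b (𝓝 0) (𝓟 {c | ∀ i, c i ∈ I}) := by
    refine tendsto_of_subseq_tendsto fun hs hhs => ?_
    obtain ⟨φ, W, hW, c, -, -, hc, hWc⟩ := exists_subseq_unitaryConj
      (fun k => hV (hs k)) ((tendsto_unitaryConj_add_smul hdec).comp hhs)
    refine ⟨φ, tendsto_principal.2 (eventually_all.2 fun i => ?_)⟩
    obtain ⟨j, hj⟩ := exists_eq_of_unitaryConj_eq hU hW hWc.symm i
    exact (tendsto_pi_nhds.1 hc i).eventually (hI.mem_nhds (hj ▸ ha j))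
  exact tendsto_principal.1 this

/-- The functional calculus of a `C¹` function is differentiable along lines. -/
lemma tendsto_slope_unitaryConj (hI : IsOpen I) (hf : ContDiffOn ℝ 1 f I)
    (hU : U ∈ unitaryGroup (Fin n) ℂ) (ha : ∀ i, a i ∈ I)
    {V : ℝ → Matrix (Fin n) (Fin n) ℂ} {b : ℝ → Fin n → ℝ}
    (hV : ∀ h, V h ∈ unitaryGroup (Fin n) ℂ)
    (hdec : ∀ h : ℝ, unitaryConj (V h) (b h) = unitaryConj U a + (h : ℂ) • H) :
    Tendsto (fun h : ℝ => (h : ℂ)⁻¹ • (unitaryConj (V h) (f ∘ b h) - unitaryConj U (f ∘ a)))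
      (𝓝[≠] 0) (𝓝 (cfcDeriv f U a H)) := by
  have h1 : Tendsto (fun h : ℝ => U * (ddMatrix f a (b h) ⊙ (Uᴴ * H * V h)) * (V h)ᴴ) (𝓝 0)
      (𝓝 (cfcDeriv f U a H)) := by
    refine tendsto_of_subseq_tendsto fun hs hhs => ?_
    obtain ⟨φ, W, hW, c, -, hVlim, hc, hWc⟩ := exists_subseq_unitaryConj
      (fun k => hV (hs k)) ((tendsto_unitaryConj_add_smul hdec).comp hhs)
    refine ⟨φ, ?_⟩
    rw [← ddMatrix_conj_eq_cfcDeriv hU hW hWc.symm f H]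
    have hdd : Tendsto (fun k => ddMatrix f a (b (hs (φ k)))) atTop (𝓝 (ddMatrix f a c)) := by
      refine tendsto_pi_nhds.2 fun i => tendsto_pi_nhds.2 fun j => ?_
      obtain ⟨m, hm⟩ := exists_eq_of_unitaryConj_eq hU hW hWc.symm j
      have hcont := continuousAt_dd hI hf (ha i) (hm ▸ ha m : c j ∈ I)
      exact (Complex.continuous_ofReal.tendsto _).comp
        (hcont.tendsto.comp (tendsto_const_nhds.prodMk_nhds (tendsto_pi_nhds.1 hc j)))
    have hcont : Continuous fun p : Matrix (Fin n) (Fin n) ℂ × Matrix (Fin n) (Fin n) ℂ =>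
        U * (p.1 ⊙ (Uᴴ * H * p.2)) * p.2ᴴ := by
      have hh : Continuous fun p : Matrix (Fin n) (Fin n) ℂ × Matrix (Fin n) (Fin n) ℂ =>
          p.1 ⊙ (Uᴴ * H * p.2) := by
        refine continuous_matrix fun i j => ?_
        have h2 : Continuous fun p : Matrix (Fin n) (Fin n) ℂ × Matrix (Fin n) (Fin n) ℂ =>
          Uᴴ * H * p.2 := by fun_prop
        exact (continuous_fst.matrix_elem i j).mul (h2.matrix_elem i j)
      fun_prop
    have hpair := hdd.prodMk_nhds hVlim
    have hcomp := (hcont.tendsto (ddMatrix f a c, W)).comp hpair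
    simpa only [Function.comp_def] using hcomp
  refine (h1.mono_left nhdsWithin_le_nhds).congr' ?_
  filter_upwards [self_mem_nhdsWithin] with h hh
  have hne : (h : ℂ) ≠ 0 := by exact_mod_cast hh
  rw [unitaryConj_comp_sub hU (hV h), hdec, add_sub_cancel_left]
  have : ddMatrix f a (b h) ⊙ (Uᴴ * ((h : ℂ) • H) * V h) =
      (h : ℂ) • (ddMatrix f a (b h) ⊙ (Uᴴ * H * V h)) := by
    rw [Matrix.mul_smul, Matrix.smul_mul, hadamard_smul]
  rw [this, Matrix.mul_smul, Matrix.smul_mul, smul_smul, inv_mul_cancel₀ hne, one_smul]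

/-- Eigenvalues of a convex combination lie in any convex set containing the eigenvalues of the
two matrices. -/
lemma eigenvalues_mem_of_convex {V' : Matrix (Fin n) (Fin n) ℂ} {c : Fin n → ℝ} {t : ℝ}
    (hI : Convex ℝ I) (hU : U ∈ unitaryGroup (Fin n) ℂ) (hV : V ∈ unitaryGroup (Fin n) ℂ)
    (hV' : V' ∈ unitaryGroup (Fin n) ℂ) (ha : ∀ i, a i ∈ I) (hb : ∀ i, b i ∈ I)
    (ht0 : 0 ≤ t) (ht1 : t ≤ 1)
    (h : unitaryConj V' c =
      unitaryConj U a + (t : ℂ) • (unitaryConj V b - unitaryConj U a)) (i : Fin n) :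
    c i ∈ I := by
  have compress : ∀ {U : Matrix (Fin n) (Fin n) ℂ} {a : Fin n → ℝ},
      U ∈ unitaryGroup (Fin n) ℂ → (∀ i, a i ∈ I) →
      ((V'ᴴ * unitaryConj U a * V') i i).re ∈ I := by
    intro U a hU ha
    have hval : ((V'ᴴ * unitaryConj U a * V') i i).re =
        ∑ k, Complex.normSq ((Uᴴ * V') k i) • a k := by
      have : V'ᴴ * unitaryConj U a * V' =
          (Uᴴ * V')ᴴ * (diagonal (fun i => (a i : ℂ)) * (Uᴴ * V')) := by
        simp only [unitaryConj, conjTranspose_mul, conjTranspose_conjTranspose, Matrix.mul_assoc]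
      rw [this, mul_apply, Complex.re_sum]
      refine Finset.sum_congr rfl fun k _ => ?_
      rw [diagonal_mul, conjTranspose_apply, smul_eq_mul, Complex.normSq_apply]
      simp
      ring
    have hsum : ∑ k, Complex.normSq ((Uᴴ * V') k i) = 1 := by
      have h1 : (Uᴴ * V')ᴴ * (Uᴴ * V') = 1 := by
        rw [conjTranspose_mul, conjTranspose_conjTranspose, ← Matrix.mul_assoc,
          Matrix.mul_assoc V'ᴴ, mul_conjTranspose_self_of_mem_unitaryGroup hU, Matrix.mul_one,
          conjTranspose_mul_self_of_mem_unitaryGroup hV']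
      have h2 := congrArg Complex.re (congrFun (congrFun h1 i) i)
      rw [mul_apply, Complex.re_sum] at h2
      simpa [Complex.normSq_apply] using h2
    rw [hval]
    exact hI.sum_mem (fun k _ => Complex.normSq_nonneg _) hsum fun k _ => ha k
  have hc : c i = ((V'ᴴ * unitaryConj V' c * V') i i).re := by
    rw [mul_unitaryConj_mul_self hV', conjTranspose_mul_self_of_mem_unitaryGroup hV']
    simp
  have hmem := hI (compress hU ha) (compress hV hb) (sub_nonneg.2 ht1) ht0 (by ring)
  convert hmem using 1
  rw [hc, h]
  simp only [Matrix.mul_add, Matrix.add_mul, Matrix.mul_smul, Matrix.smul_mul, Matrix.mul_sub,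
    Matrix.sub_mul, Matrix.add_apply, Matrix.smul_apply, Matrix.sub_apply, smul_eq_mul,
    Complex.add_re,
    Complex.re_ofReal_mul, Complex.sub_re]
  ring

open scoped MatrixOrder Matrix.Norms.L2Operator in
lemma Matrix.PosSemidef.map_ofReal {M : Matrix (Fin n) (Fin n) ℝ} (hM : M.PosSemidef) :
    (M.map Complex.ofReal).PosSemidef := by
  obtain ⟨B, rfl⟩ : ∃ B : Matrix (Fin n) (Fin n) ℝ, M = Bᴴ * B :=
    CStarAlgebra.nonneg_iff_eq_star_mul_self.mp hM.nonneg
  have : (Bᴴ * B).map Complex.ofReal = (B.map Complex.ofReal)ᴴ * B.map Complex.ofReal := by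
    ext i j
    simp [mul_apply]
  rw [this]
  exact posSemidef_conjTranspose_mul_self _

lemma Matrix.PosSemidef.of_map_ofReal {M : Matrix (Fin n) (Fin n) ℝ}
    (hM : (M.map Complex.ofReal).PosSemidef) : M.PosSemidef := by
  refine PosSemidef.of_dotProduct_mulVec_nonneg ?_ fun x => ?_
  · ext i j
    have := congrFun (congrFun hM.1 i) j
    simpa using this
  · have := hM.dotProduct_mulVec_nonneg (fun i => (x i : ℂ))
    have h2 : star (fun i => (x i : ℂ)) ⬝ᵥ (M.map Complex.ofReal *ᵥ fun i => (x i : ℂ)) =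
        ((star x ⬝ᵥ (M *ᵥ x) : ℝ) : ℂ) := by
      simp [dotProduct, mulVec]
    rw [h2] at this
    exact_mod_cast this

lemma posSemidef_cfcDeriv (hL : (Matrix.of fun i j => dd f (a i) (a j)).PosSemidef)
    (hH : H.PosSemidef) (U : Matrix (Fin n) (Fin n) ℂ) : (cfcDeriv f U a H).PosSemidef :=
  (PosSemidef.hadamard hL.map_ofReal (hH.conjTranspose_mul_mul_same U)).mul_mul_conjTranspose_same U

lemma isClosed_posSemidef : IsClosed {M : Matrix (Fin n) (Fin n) ℂ | M.PosSemidef} := by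
  simp only [posSemidef_iff_dotProduct_mulVec, Set.ofPred_and, Set.ofPred_forall]
  refine (isClosed_eq (by fun_prop) continuous_id).inter (isClosed_iInter fun x => ?_)
  exact isClosed_le continuous_const (by fun_prop)

end

theorem stmt4 (n : ℕ) (hn : 1 ≤ n) (I : Set ℝ) (hI : IsOpen I) (hI' : I.OrdConnected)
    (f : ℝ → ℝ) (hf : ContDiffOn ℝ 1 f I) :
    MatMonoOn n I f ↔ ∀ l : Fin n → ℝ, (∀ i, l i ∈ I) →
      (Matrix.of fun i j => dd f (l i) (l j)).PosSemidef := by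

  constructor
  · intro hmono l hl
    set H : Matrix (Fin n) (Fin n) ℂ := vecMulVec 1 (star 1)
    have hH : H.PosSemidef := posSemidef_vecMulVec_self_star 1
    have h1 : (1 : Matrix (Fin n) (Fin n) ℂ) ∈ unitaryGroup (Fin n) ℂ := one_mem _
    have hher : ∀ h : ℝ, (unitaryConj 1 l + (h : ℂ) • H).IsHermitian := fun h =>
      (isHermitian_unitaryConj 1 l).add (by simp [IsHermitian, conjTranspose_smul, hH.1.eq])
    set V := fun h : ℝ => ((hher h).eigenvectorUnitary : Matrix (Fin n) (Fin n) ℂ)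
    set b := fun h : ℝ => (hher h).eigenvalues
    have hV : ∀ h, V h ∈ unitaryGroup (Fin n) ℂ := fun h => (hher h).eigenvectorUnitary.2
    have hdec : ∀ h : ℝ, unitaryConj (V h) (b h) = unitaryConj 1 l + (h : ℂ) • H := fun h =>
      (hher h).eq_unitaryConj.symm
    have hb := eventually_eigenvalues_mem hI h1 hl hV hdec
    have hlim := tendsto_slope_unitaryConj hI hf h1 hl hV hdec
    have hlim' := hlim.mono_left
      (nhdsWithin_mono 0 fun x (hx : x ∈ Ioi (0 : ℝ)) => (mem_Ioi.1 hx).ne')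
    have hA := isHermitian_unitaryConj 1 l
    have hAdec := hA.eq_unitaryConj
    have hAmem : ∀ i, hA.eigenvalues i ∈ I := fun i => by
      obtain ⟨j, hj⟩ := exists_eq_of_unitaryConj_eq h1 hA.eigenvectorUnitary.2 hAdec i
      exact hj ▸ hl j
    have hAcfc : hA.cfc f = unitaryConj 1 (f ∘ l) :=
      (unitaryConj_comp_eq h1 hA.eigenvectorUnitary.2 hAdec f).symm
    have hpsd : (cfcDeriv f 1 l H).PosSemidef := by
      refine isClosed_posSemidef.mem_of_tendsto hlim' ?_
      filter_upwards [self_mem_nhdsWithin, nhdsWithin_le_nhds hb] with h hh hbh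
      have hpos : (0 : ℝ) < h := hh
      have hsub := hmono _ _ hA (hher h) hAmem hbh
        (by rw [add_sub_cancel_left]; exact hH.smul (by exact_mod_cast hpos.le))
      rw [hAcfc] at hsub
      refine PosSemidef.smul hsub ?_
      exact_mod_cast (inv_pos.2 hpos).le
    refine PosSemidef.of_map_ofReal ?_
    convert hpsd using 1
    ext i j
    simp [cfcDeriv, ddMatrix, H]
  · intro hL A B hA hB hAI hBI hAB
    have hher : ∀ t : ℝ, (A + (t : ℂ) • (B - A)).IsHermitian := fun t =>
      hA.add (by simp [IsHermitian, conjTranspose_smul, hA.eq, hB.eq])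
    set V := fun t : ℝ => ((hher t).eigenvectorUnitary : Matrix (Fin n) (Fin n) ℂ)
    set b := fun t : ℝ => (hher t).eigenvalues
    have hV : ∀ t, V t ∈ unitaryGroup (Fin n) ℂ := fun t => (hher t).eigenvectorUnitary.2
    have hdec : ∀ t : ℝ, unitaryConj (V t) (b t) = A + (t : ℂ) • (B - A) := fun t =>
      (hher t).eq_unitaryConj.symm
    have hbI : ∀ t ∈ Icc (0 : ℝ) 1, ∀ i, b t i ∈ I := fun t ht =>
      eigenvalues_mem_of_convex hI'.convex hA.eigenvectorUnitary.2 hB.eigenvectorUnitary.2 (hV t)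
        hAI hBI ht.1 ht.2 (by rw [← hA.eq_unitaryConj, ← hB.eq_unitaryConj]; exact hdec t)
    have hslope : ∀ t ∈ Icc (0 : ℝ) 1, Tendsto (fun h : ℝ => (h : ℂ)⁻¹ •
        (unitaryConj (V (t + h)) (f ∘ b (t + h)) - unitaryConj (V t) (f ∘ b t)))
        (𝓝[≠] 0) (𝓝 (cfcDeriv f (V t) (b t) (B - A))) := fun t ht => by
      refine tendsto_slope_unitaryConj (V := fun h => V (t + h)) (b := fun h => b (t + h))
        hI hf (hV t) (hbI t ht) (fun h => hV _) fun h => ?_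
      rw [hdec, hdec, add_assoc, ← add_smul]
      push_cast
      rfl
    have hcfc0 : hA.cfc f = unitaryConj (V 0) (f ∘ b 0) :=
      unitaryConj_comp_eq hA.eigenvectorUnitary.2 (hV 0)
        (by rw [← hA.eq_unitaryConj, hdec]; simp) f
    have hcfc1 : hB.cfc f = unitaryConj (V 1) (f ∘ b 1) :=
      unitaryConj_comp_eq hB.eigenvectorUnitary.2 (hV 1)
        (by rw [← hB.eq_unitaryConj, hdec]; simp) f
    rw [hcfc0, hcfc1]
    refine PosSemidef.of_dotProduct_mulVec_nonneg
      ((isHermitian_unitaryConj _ _).sub (isHermitian_unitaryConj _ _)) fun x => ?_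
    rw [Complex.nonneg_iff]
    constructor
    swap
    · have := ((isHermitian_unitaryConj (V 1) (f ∘ b 1)).sub
        (isHermitian_unitaryConj (V 0) (f ∘ b 0))).im_star_dotProduct_mulVec_self x
      exact this.symm
    set q : Matrix (Fin n) (Fin n) ℂ → ℝ := fun M => (star x ⬝ᵥ (M *ᵥ x)).re with hq
    have hqc : Continuous q := Complex.continuous_re.comp (by fun_prop)
    have hqs : ∀ M N, q (M - N) = q M - q N := fun M N => by
      simp [hq, sub_mulVec, dotProduct_sub]
    have hqr : ∀ (r : ℝ) M, q ((r : ℂ)⁻¹ • M) = r⁻¹ * q M := fun r M => by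
      simp only [hq, smul_mulVec, dotProduct_smul, smul_eq_mul]
      rw [← Complex.ofReal_inv, Complex.re_ofReal_mul]
    have hder : ∀ t ∈ Icc (0 : ℝ) 1, HasDerivAt (fun t => q (unitaryConj (V t) (f ∘ b t)))
        (q (cfcDeriv f (V t) (b t) (B - A))) t := fun t ht => by
      rw [hasDerivAt_iff_tendsto_slope_zero]
      refine ((hqc.tendsto _).comp (hslope t ht)).congr fun h => ?_
      simp only [Function.comp_apply, hqr, hqs, smul_eq_mul]
    have hmono : MonotoneOn (fun t => q (unitaryConj (V t) (f ∘ b t))) (Icc 0 1) := by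
      refine monotoneOn_of_hasDerivWithinAt_nonneg (convex_Icc 0 1)
        (fun t ht => (hder t ht).continuousAt.continuousWithinAt)
        (fun t ht => (hder t (interior_subset ht)).hasDerivWithinAt) fun t ht => ?_
      exact (Complex.nonneg_iff.1 ((posSemidef_cfcDeriv (hL _ (hbI t (interior_subset ht)))
        hAB (V t)).dotProduct_mulVec_nonneg x)).1
    have hle := hmono (left_mem_Icc.2 zero_le_one) (right_mem_Icc.2 zero_le_one) zero_le_one
    change 0 ≤ q _
    rw [hqs]
    exact sub_nonneg.2 hle

end
end

section
/- Let f ∈ C¹(I) on an open interval I, let x be the n×n diagonal matrix with diagonal entries λ₁,…,λₙ ∈ I, and let h be Hermitian. Then for every ξ ∈ ℂⁿ, the derivative at t = 0 of t ↦ ⟨f(x+th)ξ, ξ⟩ equals ⟨(h ∘ L(λ₁,…,λₙ))ξ, ξ⟩, where ∘ denotes the Hadamard (entrywise) product and L is the Löwner matrix of f. -/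
open Matrix Set
open scoped ComplexOrder

noncomputable section

open scoped Topology in
open scoped Matrix.Norms.L2Operator in
theorem continuousAt_matrix_cfc {ι : Type*} [Fintype ι] [DecidableEq ι] {X : Type*}
    [TopologicalSpace X] {x₀ : X} {A : X → Matrix ι ι ℂ} (hA : ContinuousAt A x₀)
    (hherm : ∀ x, (A x).IsHermitian) {s : Set ℝ} (hs : s ∈ 𝓝ˢ (spectrum ℝ (A x₀)))
    {g : ℝ → ℝ} (hg : ContinuousOn g s) : ContinuousAt (fun x => cfc g (A x)) x₀ := by
  obtain ⟨k, ⟨hk₁, hk₂⟩, hks⟩ :=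
    (ContinuousFunctionalCalculus.isCompact_spectrum (R := ℝ) (A x₀)
      ).nhdsSet_basis_isCompact.mem_iff.mp hs
  have hspec := hA.eventually ((upperHemicontinuous_spectrum ℝ (Matrix ι ι ℂ)).upperHemicontinuousAt
    (A x₀) _ hk₁)
  refine hA.cfc hk₂ g ?_ (.of_forall hherm) (hg.mono hks)
  filter_upwards [hspec] with x hx
  exact subset_of_mem_nhdsSet hx

/-- Newton interpolation at the node `c`, in the functional calculus of a Hermitian matrix. -/
theorem matrix_cfc_eq_add_mul_dslope {ι : Type*} [Fintype ι] [DecidableEq ι]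
    {A : Matrix ι ι ℂ} (hA : A.IsHermitian) (f : ℝ → ℝ) (c : ℝ) :
    cfc f A = algebraMap ℝ _ (f c) + (A - algebraMap ℝ _ c) * cfc (dslope f c) A := by
  have hA' : IsSelfAdjoint A := hA
  have hc : ∀ g : ℝ → ℝ, ContinuousOn g (spectrum ℝ A) := fun g =>
    A.finite_real_spectrum.continuousOn g
  have hsub : A - algebraMap ℝ _ c = cfc (fun x : ℝ => x - c) A := by
    rw [cfc_sub (fun x : ℝ => x) (fun _ => c) A (hc _) (hc _), cfc_id' ℝ A, cfc_const c A]
  rw [hsub, ← cfc_mul _ _ A (hc _) (hc _), ← cfc_const_add (f c) _ A (hc _)]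
  congr 1
  ext x
  linear_combination -sub_smul_dslope f c x

theorem dslope_eq_dd (f : ℝ → ℝ) (t s : ℝ) : dslope f t s = dd f t s := by
  rcases eq_or_ne t s with rfl | hne
  · simp [dd]
  · rw [dslope_of_ne _ hne.symm, slope_comm, slope_def_field, dd, if_neg hne]

/-- The first-order expansion of the functional calculus at a diagonal matrix, entry by entry. -/
theorem cfc_diagonal_add_smul_apply {ι : Type*} [Fintype ι] [DecidableEq ι] (l : ι → ℝ)
    (h : Matrix ι ι ℂ) (t : ℝ)
    (hherm : (diagonal (fun i => (l i : ℂ)) + (t : ℂ) • h).IsHermitian) (f : ℝ → ℝ) (i j : ι) :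
    cfc f (diagonal (fun i => (l i : ℂ)) + (t : ℂ) • h) i j =
      diagonal (fun i => (f (l i) : ℂ)) i j +
        t * (h * cfc (dslope f (l i)) (diagonal (fun i => (l i : ℂ)) + (t : ℂ) • h)) i j := by
  rw [matrix_cfc_eq_add_mul_dslope hherm f (l i)]
  set G := cfc (dslope f (l i)) (diagonal (fun i => (l i : ℂ)) + (t : ℂ) • h)
  simp only [Matrix.add_apply, Matrix.add_mul, Matrix.sub_mul, Matrix.sub_apply, Matrix.smul_mul,
    Matrix.smul_apply, diagonal_mul, Matrix.algebraMap_eq_diagonal, smul_eq_mul]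
  simp [diagonal_apply]

theorem cfc_diagonal_ofReal {ι : Type*} [Fintype ι] [DecidableEq ι] (l : ι → ℝ) (f : ℝ → ℝ) :
    cfc f (diagonal (fun i => (l i : ℂ))) = diagonal (fun i => (f (l i) : ℂ)) := by
  have hd : (diagonal (fun i => (l i : ℂ)) + ((0 : ℝ) : ℂ) • (0 : Matrix ι ι ℂ)).IsHermitian := by
    simp [IsHermitian, diagonal_conjTranspose, Pi.star_def]
  ext i j
  simpa using cfc_diagonal_add_smul_apply l 0 0 hd f i j

theorem spectrum_real_diagonal_ofReal {ι : Type*} [Fintype ι] [DecidableEq ι] (l : ι → ℝ) :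
    spectrum ℝ (diagonal (fun i => (l i : ℂ))) = range l := by
  ext x
  rw [← spectrum.algebraMap_mem_iff ℂ, spectrum_diagonal]
  simp

theorem hasDerivAt_cfc_diagonal_add_smul_apply {ι : Type*} [Fintype ι] [DecidableEq ι]
    {I : Set ℝ} (hI : IsOpen I) {f : ℝ → ℝ} (hf : DifferentiableOn ℝ f I) (l : ι → ℝ)
    (hl : ∀ i, l i ∈ I) (h : Matrix ι ι ℂ)
    (hherm : ∀ t : ℝ, (diagonal (fun i => (l i : ℂ)) + (t : ℂ) • h).IsHermitian) (i j : ι) :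
    HasDerivAt (fun t : ℝ => cfc f (diagonal (fun i => (l i : ℂ)) + (t : ℂ) • h) i j)
      (h i j * dd f (l i) (l j)) 0 := by
  have hg : ContinuousOn (dslope f (l i)) I :=
    (continuousOn_dslope (hI.mem_nhds (hl i))).2
      ⟨hf.continuousOn, hf.differentiableAt (hI.mem_nhds (hl i))⟩
  have hspec : I ∈ nhdsSet (spectrum ℝ (diagonal (fun i => (l i : ℂ)) + ((0 : ℝ) : ℂ) • h)) := by
    rw [hI.mem_nhdsSet, Complex.ofReal_zero, zero_smul, add_zero, spectrum_real_diagonal_ofReal]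
    exact range_subset_iff.2 hl
  have hcont := continuousAt_matrix_cfc (x₀ := (0 : ℝ))
    (A := fun t : ℝ => diagonal (fun i => (l i : ℂ)) + (t : ℂ) • h)
    (by fun_prop) hherm hspec hg
  have hcont' : ContinuousAt (fun t : ℝ =>
      (h * cfc (dslope f (l i)) (diagonal (fun i => (l i : ℂ)) + (t : ℂ) • h)) i j) 0 :=
    ((continuous_const.matrix_mul continuous_id).matrix_elem i j).continuousAt.comp hcont
  have hval : (h * cfc (dslope f (l i)) (diagonal (fun i => (l i : ℂ)) + ((0 : ℝ) : ℂ) • h)) i j =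
      h i j * dd f (l i) (l j) := by
    rw [Complex.ofReal_zero, zero_smul, add_zero, cfc_diagonal_ofReal, mul_diagonal, dslope_eq_dd]
  rw [hasDerivAt_iff_tendsto_slope_zero, ← hval]
  refine (hcont'.tendsto.mono_left nhdsWithin_le_nhds).congr' ?_
  filter_upwards [self_mem_nhdsWithin] with t ht
  have ht' : (t : ℂ) ≠ 0 := Complex.ofReal_ne_zero.2 ht
  rw [zero_add, cfc_diagonal_add_smul_apply l h t (hherm t),
    cfc_diagonal_add_smul_apply l h 0 (hherm 0), Complex.real_smul]
  push_cast
  field_simp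
  ring

theorem stmt5 (n : ℕ) (I : Set ℝ) (hI : IsOpen I) (hI' : I.OrdConnected)
    (f : ℝ → ℝ) (hf : ContDiffOn ℝ 1 f I)
    (l : Fin n → ℝ) (hl : ∀ i, l i ∈ I)
    (h : Matrix (Fin n) (Fin n) ℂ) (hh : h.IsHermitian)
    (hherm : ∀ t : ℝ, (Matrix.diagonal (fun i => ((l i : ℂ))) + (t : ℂ) • h).IsHermitian)
    (ξ : Fin n → ℂ) :
    HasDerivAt (fun t : ℝ => star ξ ⬝ᵥ ((hherm t).cfc f *ᵥ ξ))
      (star ξ ⬝ᵥ ((Matrix.hadamard h (Matrix.of fun i j => ((dd f (l i) (l j) : ℂ)))) *ᵥ ξ))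
      0 := by
  simp only [← IsHermitian.cfc_eq, dotProduct, mulVec, hadamard_apply, of_apply]
  exact .fun_sum fun i _ => .const_mul _ <| .fun_sum fun j _ =>
    (hasDerivAt_cfc_diagonal_add_smul_apply hI (hf.differentiableOn one_ne_zero) l hl h hherm
      i j).mul_const _

end
end

section
/- Let f ∈ C²(I) on an open interval I. Then f is operator convex if and only if for each t₀ ∈ I, the divided-difference function g(t) = (f(t) − f(t₀))/(t − t₀) for t ≠ t₀ and g(t₀) = f'(t₀) is operator monotone on I. -/
open Matrix Set
open scoped ComplexOrder

noncomputable section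

section

open Polynomial Topology Filter
open scoped MatrixOrder Matrix.Norms.L2Operator

variable {m n : Type*} [Fintype m] [DecidableEq m] [Fintype n] [DecidableEq n]

lemma Matrix.continuousOn_spectrum_real (A : Matrix n n ℂ) (g : ℝ → ℝ) :
    ContinuousOn g (spectrum ℝ A) :=
  A.finite_real_spectrum.continuousOn g

lemma Polynomial.exists_eval_eq_on_finite {S : Set ℝ} (hS : S.Finite) (g : ℝ → ℝ) :
    ∃ p : ℝ[X], ∀ x ∈ S, p.eval x = g x := by
  classical
  refine ⟨Lagrange.interpolate hS.toFinset id g, fun x hx => ?_⟩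
  exact Lagrange.eval_interpolate_at_node (v := id) g (Function.injective_id.injOn)
    (hS.mem_toFinset.2 hx)

lemma Matrix.aeval_mul_eq_mul_aeval {W : Matrix m m ℂ} {C : Matrix n n ℂ} {Z : Matrix m n ℂ}
    (h : W * Z = Z * C) (p : ℝ[X]) : aeval W p * Z = Z * aeval C p := by
  induction p using Polynomial.induction_on' with
  | add p q hp hq => rw [map_add, map_add, Matrix.add_mul, Matrix.mul_add, hp, hq]
  | monomial k a =>
    have hk : W ^ k * Z = Z * C ^ k := by
      induction k with
      | zero => simp
      | succ k ih => rw [pow_succ, Matrix.mul_assoc, h, ← Matrix.mul_assoc, ih, Matrix.mul_assoc,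
          ← pow_succ]
    simp [aeval_monomial, Algebra.algebraMap_eq_smul_one, hk]

/-- The functional calculus respects intertwiners. -/
lemma Matrix.cfc_mul_eq_mul_cfc {W : Matrix m m ℂ} {C : Matrix n n ℂ} (hW : W.IsHermitian)
    (hC : C.IsHermitian) {Z : Matrix m n ℂ} (h : W * Z = Z * C) (g : ℝ → ℝ) :
    cfc g W * Z = Z * cfc g C := by
  obtain ⟨p, hp⟩ := Polynomial.exists_eval_eq_on_finite
    (W.finite_real_spectrum.union C.finite_real_spectrum) g
  rw [← cfc_congr (f := p.eval) fun x hx => hp x (Or.inl hx),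
    ← cfc_congr (a := C) (f := p.eval) fun x hx => hp x (Or.inr hx),
    cfc_polynomial p W hW.isSelfAdjoint, cfc_polynomial p C hC.isSelfAdjoint]
  exact aeval_mul_eq_mul_aeval h p

lemma Matrix.cfc_submatrix {A : Matrix m m ℂ} (hA : A.IsHermitian) (e : n ≃ m) (g : ℝ → ℝ) :
    cfc g (A.submatrix e e) = (cfc g A).submatrix e e := by
  have h := cfc_mul_eq_mul_cfc (hA.submatrix e) hA (Z := (1 : Matrix m m ℂ).submatrix e id)
    (by rw [Matrix.submatrix_mul_equiv, ← Matrix.submatrix_id_id A]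
        conv_rhs => rw [Matrix.submatrix_id_id, ← Matrix.submatrix_id_id A]
        rw [← Matrix.submatrix_mul _ _ _ _ _ Function.bijective_id]
        simp) g
  ext i j
  have := congr_fun (congr_fun h i) (e j)
  simpa [Matrix.mul_apply, Matrix.one_apply] using this

lemma Matrix.spectrum_subset_Icc_iff {A : Matrix n n ℂ} (hA : A.IsHermitian) {a b : ℝ} :
    spectrum ℝ A ⊆ Icc a b ↔ algebraMap ℝ _ a ≤ A ∧ A ≤ algebraMap ℝ _ b := by
  rw [algebraMap_le_iff_le_spectrum (a := A) hA.isSelfAdjoint,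
    le_algebraMap_iff_spectrum_le (a := A) hA.isSelfAdjoint]
  exact ⟨fun h => ⟨fun x hx => (h hx).1, fun x hx => (h hx).2⟩,
    fun h x hx => ⟨h.1 x hx, h.2 x hx⟩⟩

lemma Matrix.IsHermitian.eigenvalues_mem_iff {A : Matrix n n ℂ} (hA : A.IsHermitian)
    {I : Set ℝ} : (∀ i, hA.eigenvalues i ∈ I) ↔ spectrum ℝ A ⊆ I := by
  rw [hA.spectrum_real_eq_range_eigenvalues, Set.range_subset_iff]

lemma matMonoOn_iff {k : ℕ} {I : Set ℝ} {g : ℝ → ℝ} : MatMonoOn k I g ↔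
    ∀ A B : Matrix (Fin k) (Fin k) ℂ, A.IsHermitian → B.IsHermitian → spectrum ℝ A ⊆ I →
      spectrum ℝ B ⊆ I → A ≤ B → cfc g A ≤ cfc g B := by
  refine forall₄_congr fun A B hA hB => ?_
  rw [hA.eigenvalues_mem_iff, hB.eigenvalues_mem_iff, hA.cfc_eq, hB.cfc_eq]
  rfl

lemma MatMonoOn.cfc_le_cfc {I : Set ℝ} {g : ℝ → ℝ} (h : ∀ k, MatMonoOn k I g)
    {A B : Matrix n n ℂ} (hA : A.IsHermitian) (hB : B.IsHermitian) (hAI : spectrum ℝ A ⊆ I)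
    (hBI : spectrum ℝ B ⊆ I) (hAB : A ≤ B) : cfc g A ≤ cfc g B := by
  let e := (Fintype.equivFin n).symm
  have hs (C : Matrix n n ℂ) (hC : spectrum ℝ C ⊆ I) : spectrum ℝ (C.submatrix e e) ⊆ I := by
    rwa [← AlgEquiv.spectrum_eq (Matrix.reindexAlgEquiv ℝ ℂ e.symm) C] at hC
  have key := matMonoOn_iff.1 (h _) (A.submatrix e e) (B.submatrix e e) (hA.submatrix e)
    (hB.submatrix e) (hs A hAI) (hs B hBI) (Matrix.PosSemidef.submatrix hAB e)
  rw [cfc_submatrix hA, cfc_submatrix hB] at key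
  have key' := (Matrix.le_iff.1 key).submatrix e.symm
  have he : ((cfc g B).submatrix e e - (cfc g A).submatrix e e).submatrix e.symm e.symm =
      cfc g B - cfc g A := by
    ext i j
    simp
  rwa [he] at key'

lemma dd_eq_slope (f : ℝ → ℝ) (t s : ℝ) : (t - s) * dd f t s = f t - f s := by
  unfold dd
  split_ifs with h
  · simp [h]
  · rw [mul_div_cancel₀ _ (sub_ne_zero.2 h)]

omit [Fintype n] [DecidableEq n] in
lemma Matrix.isHermitian_real_smul {A : Matrix n n ℂ} (hA : A.IsHermitian) (r : ℝ) :
    (r • A).IsHermitian := by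
  rw [IsHermitian, conjTranspose_smul, hA.eq, star_trivial]

lemma Matrix.isHermitian_cfc (A : Matrix n n ℂ) (g : ℝ → ℝ) : (cfc g A).IsHermitian :=
  cfc_predicate g A

lemma Matrix.cfc_sub_const (A : Matrix n n ℂ) (hA : A.IsHermitian) (g : ℝ → ℝ) (c : ℝ) :
    cfc (fun t => g t - c) A = cfc g A - algebraMap ℝ _ c := by
  rw [cfc_sub _ _ A (A.continuousOn_spectrum_real _) (A.continuousOn_spectrum_real _),
    cfc_const c A hA.isSelfAdjoint]

lemma Matrix.cfc_id_sub_const (A : Matrix n n ℂ) (hA : A.IsHermitian) (c : ℝ) :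
    cfc (fun t : ℝ => t - c) A = A - algebraMap ℝ _ c := by
  rw [cfc_sub_const A hA (fun t => t), cfc_id' ℝ A hA.isSelfAdjoint]

lemma Matrix.posSemidef_fromBlocks_diagonal {A : Matrix m m ℂ} {B : Matrix n n ℂ}
    (hA : A.PosSemidef) (hB : B.PosSemidef) : (fromBlocks A 0 0 B).PosSemidef := by
  have h := (hA.mul_mul_conjTranspose_same (fromRows 1 (0 : Matrix n m ℂ))).add
    (hB.mul_mul_conjTranspose_same (fromRows (0 : Matrix m n ℂ) 1))
  have e : fromRows 1 (0 : Matrix n m ℂ) * A * (fromRows 1 (0 : Matrix n m ℂ))ᴴ +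
      fromRows (0 : Matrix m n ℂ) 1 * B * (fromRows (0 : Matrix m n ℂ) 1)ᴴ =
      fromBlocks A 0 0 B := by
    ext (i | i) (j | j) <;>
      simp [conjTranspose_fromRows_eq_fromCols_conjTranspose, fromRows_mul]
  rwa [e] at h

lemma Matrix.algebraMap_fromBlocks (r : ℝ) :
    algebraMap ℝ (Matrix (m ⊕ n) (m ⊕ n) ℂ) r =
      fromBlocks (algebraMap ℝ _ r) 0 0 (algebraMap ℝ _ r) := by
  simp only [Algebra.algebraMap_eq_smul_one, ← fromBlocks_one, fromBlocks_smul, smul_zero]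

lemma Matrix.spectrum_fromBlocks_subset_Icc {A : Matrix m m ℂ} {B : Matrix n n ℂ}
    (hA : A.IsHermitian) (hB : B.IsHermitian) {a b : ℝ} (hAI : spectrum ℝ A ⊆ Icc a b)
    (hBI : spectrum ℝ B ⊆ Icc a b) : spectrum ℝ (fromBlocks A 0 0 B) ⊆ Icc a b := by
  rw [spectrum_subset_Icc_iff hA] at hAI
  rw [spectrum_subset_Icc_iff hB] at hBI
  rw [spectrum_subset_Icc_iff (hA.fromBlocks (by simp) hB)]
  constructor
  · simpa [le_iff, algebraMap_fromBlocks, sub_eq_add_neg, fromBlocks_neg, fromBlocks_add] using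
      posSemidef_fromBlocks_diagonal (le_iff.1 hAI.1) (le_iff.1 hBI.1)
  · simpa [le_iff, algebraMap_fromBlocks, sub_eq_add_neg, fromBlocks_neg, fromBlocks_add] using
      posSemidef_fromBlocks_diagonal (le_iff.1 hAI.2) (le_iff.1 hBI.2)

/-- Jensen's inequality for the compression by an isometry `V`, when the divided difference
of `f` at a point below the spectrum is operator monotone. -/
lemma cfc_compression_le {I : Set ℝ} (hI : I.OrdConnected) {f : ℝ → ℝ} {a b : ℝ} (ha : a ∈ I)
    (hb : b ∈ I) (hf : ∀ k, MatMonoOn k I (fun t => dd f t a)) {A : Matrix m m ℂ}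
    (hA : A.IsHermitian) (hAI : spectrum ℝ A ⊆ Icc a b) {V : Matrix m n ℂ} (hV : Vᴴ * V = 1) :
    cfc f (Vᴴ * A * V) ≤ Vᴴ * cfc f A * V := by
  set g : ℝ → ℝ := fun t => dd f t a with hg
  have hIcc : Icc a b ⊆ I := hI.out ha hb
  set R := cfc (fun t => √(t - a)) A with hR
  have hRh : R.IsHermitian := isHermitian_cfc _ _
  have hRR : R * R = A - algebraMap ℝ _ a := by
    rw [hR, ← cfc_mul _ _ A (A.continuousOn_spectrum_real _) (A.continuousOn_spectrum_real _),
      cfc_congr (g := fun t => t - a) fun t ht => Real.mul_self_sqrt (sub_nonneg.2 (hAI ht).1),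
      cfc_id_sub_const A hA]
  have hRgR : R * cfc g A * R = cfc f A - algebraMap ℝ _ (f a) := by
    rw [hR, ← cfc_mul _ _ A (A.continuousOn_spectrum_real _) (A.continuousOn_spectrum_real _),
      ← cfc_mul _ _ A (A.continuousOn_spectrum_real _) (A.continuousOn_spectrum_real _),
      cfc_congr (g := fun t => f t - f a), cfc_sub_const A hA]
    intro t ht
    simp only
    rw [mul_right_comm, Real.mul_self_sqrt (sub_nonneg.2 (hAI ht).1), hg, dd_eq_slope]
  set Z := R * V with hZ
  set C := Vᴴ * A * V with hC
  have hCh : C.IsHermitian := isHermitian_conjTranspose_mul_mul V hA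
  have hZZ : Zᴴ * Z = C - algebraMap ℝ _ a := by
    rw [hZ, conjTranspose_mul, hRh.eq, Matrix.mul_assoc, ← Matrix.mul_assoc R, hRR, hC,
      Matrix.sub_mul, Matrix.mul_sub, Matrix.mul_assoc]
    simp [Algebra.algebraMap_eq_smul_one, hV]
  set W := Z * Zᴴ + algebraMap ℝ _ a with hW
  have hah : (algebraMap ℝ (Matrix m m ℂ) a).IsHermitian := by
    rw [Algebra.algebraMap_eq_smul_one]
    exact isHermitian_real_smul isHermitian_one a
  have hWh : W.IsHermitian := (isHermitian_mul_conjTranspose_self Z).add hah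
  have hWA : W ≤ A := by
    have hP : (1 - V * Vᴴ).PosSemidef := by
      have h := posSemidef_conjTranspose_mul_self (1 - V * Vᴴ)
      have h2 : V * Vᴴ * (V * Vᴴ) = V * Vᴴ := by
        rw [Matrix.mul_assoc, ← Matrix.mul_assoc Vᴴ, hV, Matrix.one_mul]
      simpa [Matrix.sub_mul, Matrix.mul_sub, h2] using h
    have h := hP.mul_mul_conjTranspose_same R
    have e : A - W = R * (1 - V * Vᴴ) * Rᴴ := by
      rw [hW, hZ, conjTranspose_mul, hRh.eq, Matrix.mul_sub, Matrix.sub_mul, Matrix.mul_one, hRR]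
      simp only [Matrix.mul_assoc]
      abel
    rwa [← e] at h
  have hWI : spectrum ℝ W ⊆ Icc a b := by
    rw [spectrum_subset_Icc_iff hWh]
    refine ⟨?_, hWA.trans ((spectrum_subset_Icc_iff hA).1 hAI).2⟩
    rw [le_iff, hW, add_sub_cancel_right]
    exact posSemidef_self_mul_conjTranspose Z
  have hmono := (le_iff.1 (MatMonoOn.cfc_le_cfc hf hWh hA (hWI.trans hIcc) (hAI.trans hIcc)
    hWA)).conjTranspose_mul_mul_same Z
  have hWZ : W * Z = Z * C := by
    have : C = Zᴴ * Z + algebraMap ℝ _ a := by rw [hZZ, sub_add_cancel]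
    rw [this, hW, Matrix.add_mul, Matrix.mul_add, Matrix.mul_assoc]
    simp [Algebra.algebraMap_eq_smul_one]
  have h1 : Zᴴ * cfc g W * Z = cfc f C - algebraMap ℝ _ (f a) := by
    rw [Matrix.mul_assoc, cfc_mul_eq_mul_cfc hWh hCh hWZ, ← Matrix.mul_assoc, hZZ]
    rw [← cfc_id_sub_const C hCh,
      ← cfc_mul _ _ C (C.continuousOn_spectrum_real _) (C.continuousOn_spectrum_real _),
      cfc_congr (g := fun t => f t - f a) fun t _ => dd_eq_slope f t a,
      cfc_sub_const C hCh]
  have h2 : Zᴴ * cfc g A * Z = Vᴴ * cfc f A * V - algebraMap ℝ _ (f a) := by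
    have : Zᴴ * cfc g A * Z = Vᴴ * (R * cfc g A * R) * V := by
      rw [hZ, conjTranspose_mul, hRh.eq]
      simp only [Matrix.mul_assoc]
    rw [this, hRgR, Matrix.mul_sub, Matrix.sub_mul]
    simp [Algebra.algebraMap_eq_smul_one, hV]
  rw [Matrix.mul_sub, Matrix.sub_mul, h1, h2, sub_sub_sub_cancel_right] at hmono
  exact hmono

lemma Matrix.IsHermitian.exists_spectrum_subset_Icc [Nonempty n] {A B : Matrix n n ℂ}
    (hA : A.IsHermitian) {I : Set ℝ} (hAI : spectrum ℝ A ⊆ I) (hBI : spectrum ℝ B ⊆ I) :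
    ∃ a ∈ I, ∃ b ∈ I, spectrum ℝ A ⊆ Icc a b ∧ spectrum ℝ B ⊆ Icc a b := by
  have hne : (spectrum ℝ A).Nonempty := by
    rw [hA.spectrum_real_eq_range_eigenvalues]
    exact range_nonempty _
  have hfin : (spectrum ℝ A ∪ spectrum ℝ B).Finite :=
    A.finite_real_spectrum.union B.finite_real_spectrum
  obtain ⟨a, ha, hmin⟩ := hfin.exists_minimalFor id _ hne.inl
  obtain ⟨b, hb, hmax⟩ := hfin.exists_maximalFor id _ hne.inl
  have hIcc : spectrum ℝ A ∪ spectrum ℝ B ⊆ Icc a b := fun x hx =>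
    ⟨(le_total a x).elim id fun h => hmin hx h, (le_total x b).elim id fun h => hmax hx h⟩
  exact ⟨a, union_subset hAI hBI ha, b, union_subset hAI hBI hb, union_subset_iff.1 hIcc⟩

lemma MatMonoOn.matConvexOn {I : Set ℝ} (hI : I.OrdConnected) {f : ℝ → ℝ}
    (hf : ∀ t₀ ∈ I, ∀ k, MatMonoOn k I (fun t => dd f t t₀)) (k : ℕ) : MatConvexOn k I f := by
  intro A B hA hB s hs hAI hBI hC
  rcases isEmpty_or_nonempty (Fin k) with hk | hk
  · rw [Subsingleton.elim (_ - _ : Matrix (Fin k) (Fin k) ℂ) 0]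
    exact PosSemidef.zero
  rw [hA.eigenvalues_mem_iff] at hAI
  rw [hB.eigenvalues_mem_iff] at hBI
  obtain ⟨a, ha, b, hb, hAab, hBab⟩ := hA.exists_spectrum_subset_Icc hAI hBI
  set V : Matrix (Fin k ⊕ Fin k) (Fin k) ℂ :=
    fromRows ((√s : ℂ) • 1) ((√(1 - s) : ℂ) • 1) with hV
  have h1 : (√s : ℂ) * √s = s := by exact_mod_cast Real.mul_self_sqrt hs.1
  have h2 : (√(1 - s) : ℂ) * √(1 - s) = 1 - s := by
    exact_mod_cast Real.mul_self_sqrt (sub_nonneg.2 hs.2)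
  have hVH : Vᴴ = fromCols ((√s : ℂ) • 1) ((√(1 - s) : ℂ) • 1) := by
    simp [hV, conjTranspose_fromRows_eq_fromCols_conjTranspose]
  have hVV (X Y : Matrix (Fin k) (Fin k) ℂ) :
      Vᴴ * fromBlocks X 0 0 Y * V = (s : ℂ) • X + ((1 : ℂ) - s) • Y := by
    rw [hVH, hV]
    simp [-Complex.coe_smul, fromCols_mul_fromBlocks, fromCols_mul_fromRows, smul_smul, h1, h2]
  have hVV1 : Vᴴ * V = 1 := by
    rw [hVH, hV]
    simp [-Complex.coe_smul, fromCols_mul_fromRows, smul_smul, h1, h2, ← add_smul]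
  have hcfc : cfc f (fromBlocks A 0 0 B) = fromBlocks (cfc f A) 0 0 (cfc f B) := by
    have hAB : (fromBlocks A 0 0 B).IsHermitian := hA.fromBlocks (by simp) hB
    have e1 := cfc_mul_eq_mul_cfc hAB hA
      (Z := fromRows (1 : Matrix (Fin k) (Fin k) ℂ) (0 : Matrix (Fin k) (Fin k) ℂ))
      (by simp [fromBlocks_mul_fromRows, fromRows_mul]) f
    have e2 := cfc_mul_eq_mul_cfc hAB hB
      (Z := fromRows (0 : Matrix (Fin k) (Fin k) ℂ) (1 : Matrix (Fin k) (Fin k) ℂ))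
      (by simp [fromBlocks_mul_fromRows, fromRows_mul]) f
    generalize cfc f (fromBlocks A 0 0 B) = X at e1 e2
    rw [← X.fromBlocks_toBlocks] at e1 e2 ⊢
    simp only [fromBlocks_mul_fromRows, fromRows_mul, Matrix.mul_one, Matrix.mul_zero, add_zero,
      zero_add, Matrix.one_mul, Matrix.zero_mul] at e1 e2
    obtain ⟨h11, h21⟩ := fromRows_inj e1
    obtain ⟨h12, h22⟩ := fromRows_inj e2
    rw [h11, h21, h12, h22]
  have key := cfc_compression_le hI ha hb (hf a ha)
    (hA.fromBlocks (by simp) hB)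
    (spectrum_fromBlocks_subset_Icc hA hB hAab hBab) hVV1
  rw [hcfc, hVV, hVV, hA.cfc_eq, hB.cfc_eq, hC.cfc_eq] at key
  exact key

lemma dd_eq_dslope (f : ℝ → ℝ) (s : ℝ) : (fun t => dd f t s) = dslope f s := by
  funext t
  by_cases h : t = s
  · simp [dd, h]
  · rw [dd, if_neg h, dslope_of_ne _ h, slope_def_field]

lemma dd_comm (f : ℝ → ℝ) (t s : ℝ) : dd f t s = dd f s t := by
  unfold dd
  rcases eq_or_ne t s with rfl | h
  · rfl
  · rw [if_neg h, if_neg h.symm, ← neg_sub (f s), ← neg_sub s, neg_div_neg_eq]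

lemma differentiableOn_dd {I : Set ℝ} (hI : IsOpen I) {f : ℝ → ℝ} (hf : ContDiffOn ℝ 2 f I)
    {x : ℝ} (hx : x ∈ I) : DifferentiableOn ℝ (fun t => dd f t x) I := by
  have hd {t : ℝ} (ht : t ∈ I) : HasDerivAt f (deriv f t) t :=
    ((hf.differentiableOn (by norm_num)).differentiableAt (hI.mem_nhds ht)).hasDerivAt
  intro y hy
  refine DifferentiableAt.differentiableWithinAt ?_
  rw [dd_eq_dslope]
  rcases eq_or_ne y x with rfl | hyx
  swap
  · exact (differentiableAt_dslope_of_ne hyx).2 (hd hy).differentiableAt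
  have hdd : HasDerivAt (deriv f) (deriv (deriv f) y) y :=
    (((contDiffOn_succ_iff_deriv_of_isOpen (n := 1) hI).1 hf).2.2.differentiableOn
      (by norm_num) |>.differentiableAt (hI.mem_nhds hx)).hasDerivAt
  have hnhds : ∀ᶠ t in 𝓝[≠] y, t ∈ I := mem_nhdsWithin_of_mem_nhds (hI.mem_nhds hx)
  have key : Tendsto (fun t => (f t - f y - (t - y) * deriv f y) / (t - y) ^ 2) (𝓝[≠] y)
      (𝓝 (deriv (deriv f) y / 2)) := by
    refine HasDerivAt.lhopital_zero_nhdsNE (f' := fun t => deriv f t - deriv f y)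
      (g' := fun t => 2 * (t - y)) ?_ ?_ ?_ ?_ ?_ ?_
    · filter_upwards [hnhds] with t ht
      simpa [Pi.sub_def] using ((hd ht).sub_const (f y)).sub
        (((hasDerivAt_id t).sub_const y).mul_const (deriv f y))
    · refine Eventually.of_forall fun t => ?_
      simpa [Pi.pow_def] using ((hasDerivAt_id t).sub_const y).pow 2
    · filter_upwards [self_mem_nhdsWithin] with t ht
      exact mul_ne_zero two_ne_zero (sub_ne_zero.2 ht)
    · have : ContinuousAt (fun t => f t - f y - (t - y) * deriv f y) y := by
        have := (hd hx).continuousAt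
        fun_prop
      simpa using this.tendsto.mono_left nhdsWithin_le_nhds
    · have : ContinuousAt (fun t => (t - y) ^ 2) y := by fun_prop
      simpa using this.tendsto.mono_left nhdsWithin_le_nhds
    · refine ((hasDerivAt_iff_tendsto_slope.1 hdd).div_const 2).congr' ?_
      filter_upwards [self_mem_nhdsWithin] with t ht
      rw [slope_def_field, div_div, mul_comm]
  refine (hasDerivAt_iff_tendsto_slope.2 (key.congr' ?_)).differentiableAt
  filter_upwards [self_mem_nhdsWithin] with t ht
  have : t - y ≠ 0 := sub_ne_zero.2 ht
  rw [slope_def_field, dslope_same, dslope_of_ne _ ht, slope_def_field]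
  field_simp

lemma continuousOn_dd {I : Set ℝ} (hI : IsOpen I) {h : ℝ → ℝ} (hh : DifferentiableOn ℝ h I)
    {y : ℝ} (hy : y ∈ I) : ContinuousOn (fun t => dd h t y) I := by
  rw [dd_eq_dslope, continuousOn_dslope (hI.mem_nhds hy)]
  exact ⟨hh.continuousOn, hh.differentiableAt (hI.mem_nhds hy)⟩

lemma deriv_dd_of_ne {f : ℝ → ℝ} {x y : ℝ} (hf : DifferentiableAt ℝ f y) (h : y ≠ x) :
    deriv (fun t => dd f t x) y = (deriv f y - dd f y x) / (y - x) := by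
  have h0 : y - x ≠ 0 := sub_ne_zero.2 h
  have hd : HasDerivAt (fun t => (f t - f x) / (t - x))
      ((deriv f y * (y - x) - (f y - f x) * 1) / (y - x) ^ 2) y :=
    (hf.hasDerivAt.sub_const (f x)).div ((hasDerivAt_id y).sub_const x) h0
  have he : (fun t => dd f t x) =ᶠ[𝓝 y] fun t => (f t - f x) / (t - x) := by
    filter_upwards [isOpen_ne.mem_nhds h] with t ht
    rw [dd, if_neg ht]
  rw [he.deriv_eq, hd.deriv, dd, if_neg h]
  field_simp

lemma dd_dd_comm {I : Set ℝ} {f : ℝ → ℝ} (hf : ∀ x ∈ I, DifferentiableAt ℝ f x) {x y : ℝ}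
    (hy : y ∈ I) (t : ℝ) : dd (fun s => dd f s t) y x = dd (fun s => dd f s x) t y := by
  have hne {h : ℝ → ℝ} {a b : ℝ} (hab : a ≠ b) : dd h a b = (h a - h b) / (a - b) := if_neg hab
  have hself {h : ℝ → ℝ} (a : ℝ) : dd h a a = deriv h a := if_pos rfl
  rcases eq_or_ne y x with rfl | hyx
  · rcases eq_or_ne y t with rfl | hyt
    · rfl
    · rw [hself, deriv_dd_of_ne (hf y hy) hyt, hne hyt.symm, hself, dd_comm f y t,
        ← neg_div_neg_eq, neg_sub, neg_sub]
  have h1 : y - x ≠ 0 := sub_ne_zero.2 hyx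
  rw [hne hyx]
  rcases eq_or_ne t y with rfl | hty
  · rw [hself, hself, deriv_dd_of_ne (hf _ hy) hyx, dd_comm f x]
  have h2 : t - y ≠ 0 := sub_ne_zero.2 hty
  rw [hne hty, dd_comm f y t, hne hty, hne hyx]
  rcases eq_or_ne t x with rfl | htx
  · rw [hself]
    field_simp
    ring
  · have h3 : t - x ≠ 0 := sub_ne_zero.2 htx
    rw [dd_comm f x t, hne htx]
    field_simp
    ring

lemma Matrix.tendsto_cfc {ι : Type*} {l : Filter ι} {I : Set ℝ} (hI : IsOpen I) {φ : ℝ → ℝ}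
    (hφ : ContinuousOn φ I) {T : ι → Matrix n n ℂ} {D : Matrix n n ℂ} (hT : Tendsto T l (𝓝 D))
    (hTh : ∀ x, (T x).IsHermitian) (hD : D.IsHermitian) (hDI : spectrum ℝ D ⊆ I) :
    (∀ᶠ x in l, spectrum ℝ (T x) ⊆ I) ∧ Tendsto (fun x => cfc φ (T x)) l (𝓝 (cfc φ D)) := by
  obtain ⟨K, ⟨hKn, hK⟩, hKI⟩ := (spectrum.isCompact (𝕜 := ℝ) D).nhdsSet_basis_isCompact.mem_iff.1
    (hI.mem_nhdsSet.2 hDI)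
  have hev : ∀ᶠ x in l, spectrum ℝ (T x) ⊆ K := hT.eventually
    ((upperHemicontinuous_spectrum ℝ (Matrix n n ℂ) |>.upperHemicontinuousAt D _ hKn).mono
      fun _ => subset_of_mem_nhdsSet)
  exact ⟨hev.mono fun x hx => hx.trans hKI, hT.cfc hK φ hev
    (Eventually.of_forall fun x => (hTh x).isSelfAdjoint) (subset_of_mem_nhdsSet hKn)
    hD.isSelfAdjoint (hφ.mono hKI)⟩

lemma Matrix.cfc_diagonal (d : n → ℝ) (g : ℝ → ℝ) :
    cfc g (diagonal fun i => (d i : ℂ)) = diagonal fun i => (g (d i) : ℂ) := by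
  have hD : (diagonal fun i => (d i : ℂ)).IsHermitian := by
    rw [isHermitian_diagonal_iff]
    exact fun i => Complex.conj_ofReal _
  ext i j
  have h := cfc_mul_eq_mul_cfc (C := algebraMap ℝ (Matrix Unit Unit ℂ) (d j))
    (Z := of fun k _ => if k = j then 1 else 0) hD
    (by rw [Algebra.algebraMap_eq_smul_one]; exact isHermitian_real_smul isHermitian_one _)
    (by
      ext k l
      simp +contextual [Algebra.algebraMap_eq_smul_one, Matrix.mul_apply, diagonal_apply]) g
  rw [cfc_algebraMap] at h
  have := congr_fun (congr_fun h i) ()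
  simpa +contextual [Algebra.algebraMap_eq_smul_one, Matrix.mul_apply, diagonal_apply,
    eq_comm] using this

/-- Newton interpolation of `f` at the nodes `x` and `y`, with remainder, for matrices. -/
lemma Matrix.cfc_eq_newton {A : Matrix n n ℂ} (hA : A.IsHermitian) (f : ℝ → ℝ) (x y : ℝ) :
    cfc f A = algebraMap ℝ _ (f x) + dd f y x • (A - algebraMap ℝ _ x) +
      (A - algebraMap ℝ _ x) * cfc (fun t => dd (fun s => dd f s x) t y) A *
        (A - algebraMap ℝ _ y) := by
  rw [← cfc_id_sub_const A hA x, ← cfc_id_sub_const A hA y, ← cfc_const (f x) A hA.isSelfAdjoint]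
  have hc (g : ℝ → ℝ) := A.continuousOn_spectrum_real g
  rw [← cfc_mul _ _ A (hc _) (hc _), ← cfc_mul _ _ A (hc _) (hc _), ← cfc_smul _ _ A (hc _),
    ← cfc_add _ _ _ (hc _) (hc _), ← cfc_add _ _ _ (hc _) (hc _)]
  refine cfc_congr fun t _ => ?_
  have h1 := dd_eq_slope f t x
  have h2 := dd_eq_slope (fun s => dd f s x) t y
  simp only [smul_eq_mul]
  linear_combination -h1 - (t - x) * h2

/-- The arrow matrix with diagonal `d` and entries `r` elsewhere in the first row and column. -/
def arrowMatrix {k : ℕ} (d : Fin (k + 1) → ℝ) (r : ℝ) : Matrix (Fin (k + 1)) (Fin (k + 1)) ℂ :=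
  diagonal (fun i => (d i : ℂ)) + r • of fun i j => if i = 0 ↔ j = 0 then 0 else 1

lemma arrowMatrix_isHermitian {k : ℕ} (d : Fin (k + 1) → ℝ) (r : ℝ) :
    (arrowMatrix d r).IsHermitian := by
  refine IsHermitian.add ?_ (Matrix.isHermitian_real_smul ?_ r)
  · rw [isHermitian_diagonal_iff]
    exact fun i => Complex.conj_ofReal _
  · ext i j
    simp [apply_ite, iff_comm]

lemma arrowMatrix_neg_mul {k : ℕ} (d : Fin (k + 1) → ℝ) (r : ℝ) :
    arrowMatrix d (-r) * diagonal (fun i => if i = 0 then -1 else 1) =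
      diagonal (fun i => if i = 0 then -1 else 1) * arrowMatrix d r := by
  ext i j
  rw [mul_diagonal, diagonal_mul]
  by_cases hi : i = 0 <;> by_cases hj : j = 0 <;>
    simp [arrowMatrix, hi, hj, diagonal_apply, eq_comm, add_comm]

lemma tendsto_arrowMatrix {k : ℕ} (d : Fin (k + 1) → ℝ) :
    Tendsto (arrowMatrix d) (𝓝 0) (𝓝 (diagonal fun i => (d i : ℂ))) := by
  have : Continuous (arrowMatrix d) := by
    unfold arrowMatrix
    fun_prop
  simpa [arrowMatrix] using this.tendsto 0

lemma cfc_arrowMatrix_succ {k : ℕ} (d : Fin (k + 1) → ℝ) (r : ℝ) (f : ℝ → ℝ) (i j : Fin k) :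
    cfc f (arrowMatrix d r) i.succ j.succ = cfc f (diagonal fun i => (d i : ℂ)) i.succ j.succ +
      r ^ 2 * cfc (fun t => dd (fun s => dd f s (d i.succ)) t (d j.succ)) (arrowMatrix d r) 0 0 := by
  rw [Matrix.cfc_eq_newton (arrowMatrix_isHermitian d r) f (d i.succ) (d j.succ),
    Matrix.cfc_diagonal]
  generalize cfc (fun t => dd (fun s => dd f s (d i.succ)) t (d j.succ)) (arrowMatrix d r) = X
  have h1 (l) : (arrowMatrix d r - algebraMap ℝ _ (d i.succ)) i.succ l =
      if l = 0 then (r : ℂ) else 0 := by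
    by_cases hl : l = 0
    · simp [arrowMatrix, hl, Algebra.algebraMap_eq_smul_one]
    · rcases eq_or_ne i.succ l with rfl | h <;>
        simp [arrowMatrix, *, Algebra.algebraMap_eq_smul_one]
  have h2 (l) : (arrowMatrix d r - algebraMap ℝ _ (d j.succ)) l j.succ =
      if l = 0 then (r : ℂ) else 0 := by
    by_cases hl : l = 0
    · simp [arrowMatrix, hl, Algebra.algebraMap_eq_smul_one, Fin.succ_ne_zero,
        (Fin.succ_ne_zero _).symm]
    · rcases eq_or_ne l j.succ with rfl | h <;>
        simp [arrowMatrix, *, Algebra.algebraMap_eq_smul_one]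
  rw [Matrix.add_apply, Matrix.add_apply, Matrix.mul_apply]
  simp only [Matrix.mul_apply, h2, Matrix.smul_apply, h1]
  rcases eq_or_ne i j with rfl | h <;>
    simp [Algebra.algebraMap_eq_smul_one, *] <;> ring

/-- The second divided differences of a matrix convex function form a positive kernel. -/
lemma MatConvexOn.posSemidef_dd_dd {I : Set ℝ} (hI : IsOpen I) {f : ℝ → ℝ}
    (hf : ContDiffOn ℝ 2 f I) {k : ℕ} (hconv : MatConvexOn (k + 1) I f) {d : Fin (k + 1) → ℝ}
    (hd : ∀ i, d i ∈ I) :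
    (of fun i j : Fin k =>
      (dd (fun s => dd f s (d i.succ)) (d 0) (d j.succ) : ℂ)).PosSemidef := by
  set D : Matrix (Fin (k + 1)) (Fin (k + 1)) ℂ := diagonal fun i => (d i : ℂ) with hD
  have hDh : D.IsHermitian := by
    rw [hD, isHermitian_diagonal_iff]
    exact fun i => Complex.conj_ofReal _
  have hDI : spectrum ℝ D ⊆ I := by
    intro t ht
    rw [← spectrum.algebraMap_mem_iff ℂ, hD, spectrum_diagonal] at ht
    obtain ⟨i, hi⟩ := ht
    rw [← show d i = t from Complex.ofReal_injective hi]
    exact hd i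
  have hlim (φ : ℝ → ℝ) (hφ : ContinuousOn φ I) := Matrix.tendsto_cfc hI hφ
    (tendsto_arrowMatrix d) (arrowMatrix_isHermitian d) hDh hDI
  have hF (i j : Fin k) :
      ContinuousOn (fun t => dd (fun s => dd f s (d i.succ)) t (d j.succ)) I :=
    continuousOn_dd hI (differentiableOn_dd hI hf (hd _)) (hd _)
  set F : Matrix (Fin (k + 1)) (Fin (k + 1)) ℂ → Matrix (Fin k) (Fin k) ℂ := fun A =>
    of fun i j => cfc (fun t => dd (fun s => dd f s (d i.succ)) t (d j.succ)) A 0 0 with hFdef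
  have hFlim : Tendsto (fun r => F (arrowMatrix d r)) (𝓝[>] 0) (𝓝 (F D)) := by
    refine tendsto_pi_nhds.2 fun i => tendsto_pi_nhds.2 fun j => ?_
    exact tendsto_pi_nhds.1 (tendsto_pi_nhds.1
      ((hlim _ (hF i j)).2.mono_left nhdsWithin_le_nhds) 0) 0
  have hFD : F D = of fun i j : Fin k =>
      (dd (fun s => dd f s (d i.succ)) (d 0) (d j.succ) : ℂ) := by
    ext i j
    simp [hFdef, hD, Matrix.cfc_diagonal]
  rw [← hFD, ← Matrix.nonneg_iff_posSemidef]
  refine ge_of_tendsto hFlim ?_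
  have hpos := (hlim f hf.continuousOn).1
  have hneg := (continuous_neg.tendsto' (0 : ℝ) 0 neg_zero).eventually hpos
  filter_upwards [hpos.filter_mono nhdsWithin_le_nhds, hneg.filter_mono nhdsWithin_le_nhds,
    self_mem_nhdsWithin] with r hr hr' hr0
  have hT := arrowMatrix_isHermitian d r
  have hT' := arrowMatrix_isHermitian d (-r)
  have hmid : ((1 / 2 : ℝ) : ℂ) • arrowMatrix d r + ((1 : ℂ) - (1 / 2 : ℝ)) • arrowMatrix d (-r) =
      D := by
    ext i j
    simp [arrowMatrix, hD]
    ring_nf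
  have h := hconv (arrowMatrix d r) (arrowMatrix d (-r)) hT hT' (1 / 2) (by norm_num)
    (hT.eigenvalues_mem_iff.2 hr) (hT'.eigenvalues_mem_iff.2 hr') (by rwa [hmid])
  rw [← hT.cfc_eq, ← hT'.cfc_eq, ← IsHermitian.cfc_eq, hmid] at h
  have hr2 : (0 : ℝ) ≤ (r ^ 2)⁻¹ := by positivity
  have hrc : (r : ℂ) ≠ 0 := Complex.ofReal_ne_zero.2 (ne_of_gt hr0)
  have h' := (h.submatrix Fin.succ).smul hr2
  have hsymm (i j : Fin k) : cfc f (arrowMatrix d (-r)) i.succ j.succ =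
      cfc f (arrowMatrix d r) i.succ j.succ := by
    have := congr_fun (congr_fun (Matrix.cfc_mul_eq_mul_cfc hT' hT (arrowMatrix_neg_mul d r) f)
      i.succ) j.succ
    rw [mul_diagonal, diagonal_mul] at this
    simpa using this
  have e : (r ^ 2)⁻¹ • ((((1 / 2 : ℝ) : ℂ) • cfc f (arrowMatrix d r) +
      ((1 : ℂ) - (1 / 2 : ℝ)) • cfc f (arrowMatrix d (-r))) - cfc f D).submatrix Fin.succ Fin.succ =
      F (arrowMatrix d r) := by
    ext i j
    have h1 := cfc_arrowMatrix_succ d r f i j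
    simp only [Matrix.smul_apply, submatrix_apply, Matrix.sub_apply, Matrix.add_apply, hsymm, h1,
      hFdef, of_apply, Complex.real_smul, smul_eq_mul, ← hD]
    push_cast
    field_simp
    ring
  rw [e] at h'
  exact Matrix.nonneg_iff_posSemidef.2 h'

lemma Matrix.cfc_eq_slope {A : Matrix n n ℂ} (hA : A.IsHermitian) (g : ℝ → ℝ) (x : ℝ) :
    cfc g A = algebraMap ℝ _ (g x) + (A - algebraMap ℝ _ x) * cfc (fun t => dd g t x) A := by
  have hc (g : ℝ → ℝ) := A.continuousOn_spectrum_real g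
  rw [← cfc_id_sub_const A hA x, ← cfc_const (g x) A hA.isSelfAdjoint,
    ← cfc_mul _ _ A (hc _) (hc _), ← cfc_add _ _ _ (hc _) (hc _)]
  refine cfc_congr fun t _ => ?_
  linear_combination -dd_eq_slope g t x

/-- The Daletskii-Krein formula at a Hermitian matrix `M`, with positivity of the derivative. -/
lemma Matrix.exists_hasDerivAt_cfc {I : Set ℝ} (hI : IsOpen I) {g : ℝ → ℝ}
    (hg : ∀ x ∈ I, ContinuousOn (fun t => dd g t x) I)
    (hpos : ∀ d : n → ℝ, (∀ i, d i ∈ I) → (of fun i j => (dd g (d j) (d i) : ℂ)).PosSemidef)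
    {M H : Matrix n n ℂ} (hM : M.IsHermitian) (hMI : spectrum ℝ M ⊆ I) (hH : H.PosSemidef) :
    ∃ L : Matrix n n ℂ, L.PosSemidef ∧ HasDerivAt (fun r : ℝ => cfc g (M + r • H)) L 0 := by
  set a := hM.eigenvalues with ha
  have haI : ∀ i, a i ∈ I := hM.eigenvalues_mem_iff.2 hMI
  set U : Matrix n n ℂ := (hM.eigenvectorUnitary : Matrix n n ℂ) with hU
  have hU1 : Uᴴ * U = 1 := Unitary.coe_star_mul_self hM.eigenvectorUnitary
  have hU2 : U * Uᴴ = 1 := Unitary.coe_mul_star_self hM.eigenvectorUnitary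
  have hDh : (diagonal fun i => (a i : ℂ)).IsHermitian := by
    rw [isHermitian_diagonal_iff]
    exact fun i => Complex.conj_ofReal _
  have hMU : M * U = U * diagonal fun i => (a i : ℂ) := by
    conv_lhs => rw [hM.spectral_theorem, Unitary.conjStarAlgAut_apply, Matrix.mul_assoc]
    rw [star_eq_conjTranspose, ← hU, hU1, Matrix.mul_one]
    rfl
  have hUM : Uᴴ * M = (diagonal fun i => (a i : ℂ)) * Uᴴ := by
    have := congr_arg conjTranspose hMU
    rwa [conjTranspose_mul, conjTranspose_mul, hM.eq, hDh.eq] at this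
  set K : Matrix n n ℂ := of fun i j => (dd g (a j) (a i) : ℂ) with hK
  refine ⟨U * ((Uᴴ * H * U) ⊙ K) * Uᴴ, ?_, ?_⟩
  · exact ((hH.conjTranspose_mul_mul_same U).hadamard (hpos a haI)).mul_mul_conjTranspose_same U
  have hT (r : ℝ) : (M + r • H).IsHermitian := hM.add (isHermitian_real_smul hH.1 r)
  have hcont : Tendsto (fun r : ℝ => M + r • H) (𝓝 0) (𝓝 M) := by
    have : Continuous fun r : ℝ => M + r • H := by fun_prop
    simpa using this.tendsto 0
  set Q : ℝ → Matrix n n ℂ := fun r =>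
    of fun i j => (Uᴴ * H * cfc (fun t => dd g t (a i)) (M + r • H) * U) i j with hQ
  have hQlim : Tendsto Q (𝓝 0) (𝓝 ((Uᴴ * H * U) ⊙ K)) := by
    refine tendsto_pi_nhds.2 fun i => tendsto_pi_nhds.2 fun j => ?_
    have h := (tendsto_cfc hI (hg _ (haI i)) hcont hT hM hMI).2
    have h2 := tendsto_pi_nhds.1 (tendsto_pi_nhds.1 ((h.const_mul (Uᴴ * H)).mul_const U) i) j
    rw [Matrix.mul_assoc (Uᴴ * H), cfc_mul_eq_mul_cfc hM hDh hMU, cfc_diagonal, ← Matrix.mul_assoc,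
      mul_diagonal] at h2
    exact h2
  have hQeq (r : ℝ) : Uᴴ * cfc g (M + r • H) * U = (diagonal fun i => (g (a i) : ℂ)) + r • Q r := by
    ext i j
    have hrow (X : Matrix n n ℂ) :
        (Uᴴ * ((M + r • H - algebraMap ℝ _ (a i)) * X) * U) i j = r * (Uᴴ * H * X * U) i j := by
      have : Uᴴ * ((M + r • H - algebraMap ℝ _ (a i)) * X) * U =
          (diagonal fun l => ((a l - a i : ℝ) : ℂ)) * (Uᴴ * X * U) + r • (Uᴴ * H * X * U) := by
        have e : (diagonal fun l => ((a l - a i : ℝ) : ℂ)) =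
            (diagonal fun l => (a l : ℂ)) - algebraMap ℝ _ (a i) := by
          ext l p
          rcases eq_or_ne l p with rfl | h <;> simp [Algebra.algebraMap_eq_smul_one, *]
        rw [e]
        simp only [Matrix.sub_mul, ← Matrix.mul_assoc, ← hUM]
        simp [Matrix.mul_add, Matrix.mul_sub, Matrix.add_mul, Matrix.sub_mul, Matrix.mul_assoc,
          Algebra.algebraMap_eq_smul_one]
        abel
      rw [this]
      simp
    rw [cfc_eq_slope (hT r) g (a i), Matrix.mul_add, Matrix.add_mul, Matrix.add_apply, hrow]
    rw [Algebra.algebraMap_eq_smul_one, Matrix.mul_smul, Matrix.mul_one, Matrix.smul_mul, hU1]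
    rcases eq_or_ne i j with rfl | h <;> simp [*]
  rw [hasDerivAt_iff_tendsto_slope]
  refine (((hQlim.const_mul U).mul_const Uᴴ).mono_left nhdsWithin_le_nhds).congr' ?_
  filter_upwards [self_mem_nhdsWithin] with r hr
  have hrec (X : Matrix n n ℂ) : X = U * (Uᴴ * X * U) * Uᴴ := by
    simp only [Matrix.mul_assoc, hU2, Matrix.mul_one]
    rw [← Matrix.mul_assoc, hU2, Matrix.one_mul]
  rw [slope_def_module, sub_zero, hrec (cfc g (M + r • H)), hrec (cfc g (M + (0 : ℝ) • H)), hQeq,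
    hQeq, ← Matrix.sub_mul, ← Matrix.mul_sub]
  simp [smul_smul, inv_mul_cancel₀ (show r ≠ 0 from hr)]

/-- Loewner's criterion: a positive kernel of divided differences implies monotonicity. -/
lemma matMonoOn_of_posSemidef_dd {I : Set ℝ} (hI : IsOpen I) (hI' : I.OrdConnected) {g : ℝ → ℝ}
    (hg : ∀ x ∈ I, ContinuousOn (fun t => dd g t x) I) {k : ℕ}
    (hpos : ∀ d : Fin k → ℝ, (∀ i, d i ∈ I) →
      (of fun i j => (dd g (d j) (d i) : ℂ)).PosSemidef) : MatMonoOn k I g := by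
  rw [matMonoOn_iff]
  intro A B hA hB hAI hBI hAB
  rcases isEmpty_or_nonempty (Fin k) with hk | hk
  · exact (Subsingleton.elim _ _).le
  obtain ⟨a, ha, b, hb, hAab, hBab⟩ := hA.exists_spectrum_subset_Icc hAI hBI
  rw [Matrix.spectrum_subset_Icc_iff hA] at hAab
  rw [Matrix.spectrum_subset_Icc_iff hB] at hBab
  set H := B - A with hH
  have hHpos : H.PosSemidef := Matrix.le_iff.1 hAB
  set T : ℝ → Matrix (Fin k) (Fin k) ℂ := fun s => A + s • H with hTdef
  have hT (s : ℝ) : (T s).IsHermitian := hA.add (Matrix.isHermitian_real_smul hHpos.1 s)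
  have hTI (s : ℝ) (hs : s ∈ Icc (0 : ℝ) 1) : spectrum ℝ (T s) ⊆ I := by
    refine Subset.trans ?_ (hI'.out ha hb)
    rw [Matrix.spectrum_subset_Icc_iff (hT s)]
    constructor
    · refine hAab.1.trans (Matrix.le_iff.2 ?_)
      simpa [hTdef] using hHpos.smul hs.1
    · refine le_trans (Matrix.le_iff.2 ?_) hBab.2
      have h := hHpos.smul (sub_nonneg.2 hs.2)
      have e : (1 - s) • H = B - T s := by
        simp only [hTdef, hH]
        module
      rwa [e] at h
  have hder (s : ℝ) (hs : s ∈ Icc (0 : ℝ) 1) : ∃ L : Matrix (Fin k) (Fin k) ℂ, L.PosSemidef ∧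
      HasDerivAt (fun r => cfc g (T r)) L s := by
    obtain ⟨L, hL, hd⟩ := Matrix.exists_hasDerivAt_cfc hI hg hpos (hT s) (hTI s hs) hHpos
    refine ⟨L, hL, ?_⟩
    rw [← sub_self s] at hd
    have := hd.comp_sub_const s s
    refine this.congr_of_eventuallyEq (Eventually.of_forall fun r => ?_)
    simp only [hTdef]
    congr 1
    module
  rw [Matrix.le_iff]
  refine PosSemidef.of_dotProduct_mulVec_nonneg
    ((Matrix.isHermitian_cfc B g).sub (Matrix.isHermitian_cfc A g)) fun v => ?_
  let ψ : Matrix (Fin k) (Fin k) ℂ →ₗ[ℝ] ℝ :=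
    { toFun := fun X => (star v ⬝ᵥ X *ᵥ v).re
      map_add' := fun X Y => by simp [Matrix.add_mulVec]
      map_smul' := fun r X => by simp [Matrix.smul_mulVec] }
  have hψ (s : ℝ) (hs : s ∈ Icc (0 : ℝ) 1) :
      ∃ L : ℝ, 0 ≤ L ∧ HasDerivAt (fun r => ψ (cfc g (T r))) L s := by
    obtain ⟨L, hL, hd⟩ := hder s hs
    exact ⟨ψ L, (Complex.nonneg_iff.1 (hL.dotProduct_mulVec_nonneg v)).1,
      ψ.toContinuousLinearMap.hasFDerivAt.comp_hasDerivAt s hd⟩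
  have hmono : MonotoneOn (fun r => ψ (cfc g (T r))) (Icc 0 1) := by
    refine monotoneOn_of_deriv_nonneg (convex_Icc 0 1) ?_ ?_ ?_
    · intro s hs
      obtain ⟨L, -, hd⟩ := hψ s hs
      exact hd.continuousAt.continuousWithinAt
    · intro s hs
      obtain ⟨L, -, hd⟩ := hψ s (interior_subset hs)
      exact hd.differentiableAt.differentiableWithinAt
    · intro s hs
      obtain ⟨L, hL, hd⟩ := hψ s (interior_subset hs)
      rwa [hd.deriv]
  have h01 := hmono (left_mem_Icc.2 zero_le_one) (right_mem_Icc.2 zero_le_one) zero_le_one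
  have hT0 : T 0 = A := by simp [hTdef]
  have hT1 : T 1 = B := by simp [hTdef, hH]
  simp only [hT0, hT1] at h01
  rw [← sub_nonneg, ← map_sub] at h01
  exact Complex.nonneg_iff.2 ⟨h01, (IsHermitian.im_star_dotProduct_mulVec_self
    ((Matrix.isHermitian_cfc B g).sub (Matrix.isHermitian_cfc A g)) v).symm⟩

lemma MatConvexOn.matMonoOn_dd {I : Set ℝ} (hI : IsOpen I) (hI' : I.OrdConnected) {f : ℝ → ℝ}
    (hf : ContDiffOn ℝ 2 f I) {k : ℕ} (hconv : MatConvexOn (k + 1) I f) {t₀ : ℝ} (ht₀ : t₀ ∈ I) :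
    MatMonoOn k I (fun t => dd f t t₀) := by
  refine matMonoOn_of_posSemidef_dd hI hI'
    (fun x hx => continuousOn_dd hI (differentiableOn_dd hI hf ht₀) hx) fun d hd => ?_
  have h := hconv.posSemidef_dd_dd hI hf (d := Fin.cons t₀ d) (Fin.cases ht₀ hd)
  simp only [Fin.cons_succ, Fin.cons_zero] at h
  have hdiff : ∀ x ∈ I, DifferentiableAt ℝ f x := fun x hx =>
    (hf.differentiableOn (by norm_num)).differentiableAt (hI.mem_nhds hx)
  simpa only [dd_dd_comm hdiff (hd _)] using h

end

theorem stmt8 (I : Set ℝ) (hI : IsOpen I) (hI' : I.OrdConnected)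
    (f : ℝ → ℝ) (hf : ContDiffOn ℝ 2 f I) :
    (∀ n, MatConvexOn n I f) ↔ ∀ t₀ ∈ I, ∀ n, MatMonoOn n I (fun t => dd f t t₀) :=
  ⟨fun h _ ht₀ n => (h (n + 1)).matMonoOn_dd hI hI' hf ht₀, MatMonoOn.matConvexOn hI'⟩

end
end
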